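/- There is a constant C > 0, depending only on |𝒴|, with the following property. Let 𝒳, 𝒴 be finite sets with |𝒳| ≥ 2 and |𝒴| ≥ 2, let n ≥ 27 and l, k ∈ ℕ₊. Let M_1,…,M_l be finitely supported random variables, 𝐗 a random variable on 𝒳^n, W_1,…,W_k ∈ 𝒫(𝒴|𝒳), and 𝐘_1,…,𝐘_k random variables on 𝒴^n such that (M_1,…,M_l) ⊸ 𝐗 ⊸ (𝐘_1,…,𝐘_k) and, for each i, 𝐘_i is an output of 𝐗 through W_i^n. Then for every α ∈ (log₂(n)/n, 1/(8 ln 2)) there exist a random variable V that is a deterministic function of (𝐗, M_1,…,M_l) taking at most (2n³·log₂|𝒴|)^{lk} values, and a real δ ∈ (0, C·√α·(−log₂ α)], such that: for every finitely supported random variable U, jointly distributed with the above, from which V is almost surely recoverable as a deterministic function and which satisfies (U, M_1,…,M_l) ⊸ 𝐗 ⊸ (𝐘_1,…,𝐘_k), and for every i ∈ [1:k] and j ∈ [1:l], there is a set 𝒰_{i|j} of values of U with P(U ∈ 𝒰_{i|j}) ≥ 1 − 2^{−(n/2)·log₂(n/8)} such that for all u ∈ 𝒰_{i|j}: Pr(|h(𝐘_i|M_j,U)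 − H(𝐘_i|M_j, U=u)| > nδ + 3·h_U(u) | U=u) < 4·2^{−nα}. -/

import Mathlib

open scoped Classical BigOperators

noncomputable section

namespace Paper

variable {Ω : Type*}

/-- Probability of an event under a discrete probability distribution. -/
def pr (μ : PMF Ω) (E : Set Ω) : ℝ := (μ.toOuterMeasure E).toReal

/-- Conditional probability `Pr(E | F)`. -/
def cpr (μ : PMF Ω) (E F : Set Ω) : ℝ := pr μ (E ∩ F) / pr μ F

/-- Entropy spectrum frequency `h_X(x) = -log₂ Pr(X = x)`. -/
def hs {α : Type*} (μ : PMF Ω) (X : Ω → α) (x : α) : ℝ :=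
  - Real.logb 2 (pr μ {ω | X ω = x})

/-- Conditional entropy spectrum frequency `h_{X|Y}(x|y) = -log₂ Pr(X = x | Y = y)`. -/
def hcs {α β : Type*} (μ : PMF Ω) (X : Ω → α) (Y : Ω → β) (x : α) (y : β) : ℝ :=
  - Real.logb 2 (cpr μ {ω | X ω = x} {ω | Y ω = y})

/-- Conditional Shannon entropy (bits) `H(X|Y)`. -/
def Hc {α β : Type*} [Fintype α] [Fintype β] (μ : PMF Ω) (X : Ω → α) (Y : Ω → β) : ℝ :=
  - ∑ x : α, ∑ y : β, pr μ ({ω | X ω = x} ∩ {ω | Y ω = y}) *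
      Real.logb 2 (cpr μ {ω | X ω = x} {ω | Y ω = y})

/-- Shannon entropy (bits) of `X` conditioned on the event `E`. -/
def HEvt {α : Type*} [Fintype α] (μ : PMF Ω) (X : Ω → α) (E : Set Ω) : ℝ :=
  - ∑ x : α, cpr μ {ω | X ω = x} E * Real.logb 2 (cpr μ {ω | X ω = x} E)

/-- Conditional Shannon entropy (bits) `H(X|Y)` computed given the event `E`. -/
def HcEvt {α β : Type*} [Fintype α] [Fintype β] (μ : PMF Ω) (X : Ω → α) (Y : Ω → β)
    (E : Set Ω) : ℝ :=
  - ∑ x : α, ∑ y : β, cpr μ ({ω | X ω = x} ∩ {ω | Y ω = y}) E *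
      Real.logb 2 (cpr μ {ω | X ω = x} ({ω | Y ω = y} ∩ E))

/-- `A ⊸ B ⊸ C` : `A` and `C` are conditionally independent given `B`. -/
def Markov {α β γ : Type*} (μ : PMF Ω) (A : Ω → α) (B : Ω → β) (C : Ω → γ) : Prop :=
  ∀ a b c, pr μ {ω | A ω = a ∧ B ω = b ∧ C ω = c} * pr μ {ω | B ω = b} =
    pr μ {ω | A ω = a ∧ B ω = b} * pr μ {ω | B ω = b ∧ C ω = c}

/-- A discrete memoryless channel from `𝒳` to `𝒴`. -/
structure Channel (𝒳 𝒴 : Type*) [Fintype 𝒴] where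
  w : 𝒳 → 𝒴 → ℝ
  nonneg : ∀ x y, 0 ≤ w x y
  sum_one : ∀ x, ∑ y, w x y = 1

/-- The `n`-fold product channel `W^n(𝐲|𝐱)`. -/
def Channel.pn {𝒳 𝒴 : Type*} [Fintype 𝒴] (W : Channel 𝒳 𝒴) (n : ℕ)
    (x : Fin n → 𝒳) (y : Fin n → 𝒴) : ℝ := ∏ i, W.w (x i) (y i)

/-- `Y` is an output of `X` through `W^n`. -/
def IsOutput {𝒳 𝒴 : Type*} [Fintype 𝒴] {n : ℕ} (μ : PMF Ω)
    (X : Ω → Fin n → 𝒳) (Y : Ω → Fin n → 𝒴) (W : Channel 𝒳 𝒴) : Prop :=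
  ∀ x y, 0 < pr μ {ω | X ω = x} → cpr μ {ω | Y ω = y} {ω | X ω = x} = W.pn n x y

/-- `W^n(B|𝐱)`. -/
def imgMass {𝒳 𝒴 : Type*} [Fintype 𝒴] (W : Channel 𝒳 𝒴) (n : ℕ)
    (x : Fin n → 𝒳) (B : Finset (Fin n → 𝒴)) : ℝ := ∑ y ∈ B, W.pn n x y

/-- `B` is an `η`-image of `A` by `W`. -/
def IsImage {𝒳 𝒴 : Type*} [Fintype 𝒴] (W : Channel 𝒳 𝒴) (n : ℕ)
    (A : Set (Fin n → 𝒳)) (η : ℝ) (B : Finset (Fin n → 𝒴)) : Prop :=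
  ∀ x ∈ A, η ≤ imgMass W n x B

/-- Minimum cardinality of an `η`-image of `A` by `W`. -/
def gimg {𝒳 𝒴 : Type*} [Fintype 𝒴] (W : Channel 𝒳 𝒴) (n : ℕ)
    (A : Set (Fin n → 𝒳)) (η : ℝ) : ℕ :=
  sInf {k | ∃ B : Finset (Fin n → 𝒴), IsImage W n A η B ∧ B.card = k}

/-- `B` is an `η`-quasi-image of the pmf `P` by `W`. -/
def IsQImage {𝒳 𝒴 : Type*} [Fintype 𝒳] [Fintype 𝒴] (W : Channel 𝒳 𝒴) (n : ℕ)
    (P : (Fin n → 𝒳) → ℝ) (η : ℝ) (B : Finset (Fin n → 𝒴)) : Prop :=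
  η ≤ ∑ x, imgMass W n x B * P x

/-- Minimum cardinality of an `η`-quasi-image of `P` by `W`. -/
def gqimg {𝒳 𝒴 : Type*} [Fintype 𝒳] [Fintype 𝒴] (W : Channel 𝒳 𝒴) (n : ℕ)
    (P : (Fin n → 𝒳) → ℝ) (η : ℝ) : ℕ :=
  sInf {k | ∃ B : Finset (Fin n → 𝒴), IsQImage W n P η B ∧ B.card = k}

/-- The number of values in the support of `U`. -/
def suppCard {α : Type*} [Fintype α] (μ : PMF Ω) (U : Ω → α) : ℕ :=
  (Finset.univ.filter (fun u => 0 < pr μ {ω | U ω = u})).card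

/-- Mutual information (bits). -/
def MI {α β : Type*} [Fintype α] [Fintype β] (μ : PMF Ω) (A : Ω → α) (B : Ω → β) : ℝ :=
  ∑ a : α, ∑ b : β, pr μ {ω | A ω = a ∧ B ω = b} *
    Real.logb 2 (pr μ {ω | A ω = a ∧ B ω = b} / (pr μ {ω | A ω = a} * pr μ {ω | B ω = b}))

/-- Conditional mutual information (bits). -/
def CMI {α β γ : Type*} [Fintype α] [Fintype β] [Fintype γ] (μ : PMF Ω)
    (A : Ω → α) (B : Ω → β) (C : Ω → γ) : ℝ :=
  ∑ c : γ, pr μ {ω | C ω = c} * ∑ a : α, ∑ b : β,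
    cpr μ {ω | A ω = a ∧ B ω = b} {ω | C ω = c} *
      Real.logb 2 (cpr μ {ω | A ω = a ∧ B ω = b} {ω | C ω = c} /
        (cpr μ {ω | A ω = a} {ω | C ω = c} * cpr μ {ω | B ω = b} {ω | C ω = c}))

/-- `D_{wh}(w‖w'|p̂)` in the extended reals, with the stated conventions. -/
def Dkl {𝒳 𝒴 : Type*} [Fintype 𝒳] [Fintype 𝒴] (w w' wh : Channel 𝒳 𝒴)
    (p : 𝒳 → ℝ) : EReal :=
  if ∃ x y, 0 < wh.w x y * p x ∧ w'.w x y = 0 ∧ 0 < w.w x y then ⊤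
  else if ∃ x y, 0 < wh.w x y * p x ∧ w.w x y = 0 ∧ 0 < w'.w x y then ⊥
  else ((∑ x : 𝒳, ∑ y : 𝒴, wh.w x y * p x * Real.logb 2 (w.w x y / w'.w x y) : ℝ) : EReal)

/-- `sup { D_{wh}(w‖w'|p̂) }` over channels `wh` and pmfs `p̂` on `𝒳`. -/
def DklSup {𝒳 𝒴 : Type*} [Fintype 𝒳] [Fintype 𝒴] (w w' : Channel 𝒳 𝒴) : EReal :=
  sSup {d : EReal | ∃ (wh : Channel 𝒳 𝒴) (p : 𝒳 → ℝ),
    (∀ x, 0 ≤ p x) ∧ (∑ x, p x = 1) ∧ d = Dkl w w' wh p}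

theorem sum_mul_sum_le_of_mul_le {𝒴 : Type*} [Fintype 𝒴] {E c : ℝ} (hE : 1 ≤ E) (hc : 0 ≤ c)
    (q F G : 𝒴 → ℝ) (hq : ∀ y, 0 ≤ q y) (hq1 : ∑ y, q y = 1)
    (hF : ∀ y, 0 ≤ F y)
    (h : ∀ a b, F a * G b ≤ c * (if a = b then 1 else E)) :
    (∑ y, q y * F y) * (∑ y, q y * G y) ≤ c * ((1 + E) ^ 2 / (4 * E)) := by
  have hE0 : 0 < E := by linarith
  have hne : Nonempty 𝒴 := by
    by_contra hcon
    rw [not_nonempty_iff] at hcon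
    simp at hq1
  obtain ⟨y₀, hy₀⟩ := Finite.exists_max F
  set S := F y₀ with hS
  have hF0 : 0 ≤ ∑ y, q y * F y := Finset.sum_nonneg fun y _ => mul_nonneg (hq y) (hF y)
  rcases (hF y₀).eq_or_lt with h0 | hpos
  · have : ∀ y, F y = 0 := fun y => le_antisymm (by rw [h0]; exact hy₀ y) (hF y)
    simp only [this, mul_zero, Finset.sum_const_zero, zero_mul]
    positivity
  · have key : ∀ y, S ^ 2 * G y ≤ c * ((1 + E) * S - E * F y) := by
      intro y
      have h1 : S * G y ≤ c * E := by
        refine (h y₀ y).trans (mul_le_mul_of_nonneg_left ?_ hc)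
        split_ifs <;> linarith
      have h2 : F y * G y ≤ c := by simpa using h y y
      rcases le_total (F y * E) S with h3 | h3
      · have h4 : S * (S * G y) ≤ S * (c * E) := mul_le_mul_of_nonneg_left h1 hpos.le
        have h5 : c * (F y * E) ≤ c * S := mul_le_mul_of_nonneg_left h3 hc
        nlinarith
      · have hFy : 0 < F y := by
          by_contra hcon
          have : F y = 0 := le_antisymm (not_lt.1 hcon) (hF y)
          rw [this, zero_mul] at h3
          linarith
        refine le_of_mul_le_mul_left ?_ hFy
        have h4 : S ^ 2 * (F y * G y) ≤ S ^ 2 * c := mul_le_mul_of_nonneg_left h2 (sq_nonneg _)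
        have h5 : 0 ≤ c * ((S - F y) * (F y * E - S)) :=
          mul_nonneg hc (mul_nonneg (sub_nonneg.2 (hy₀ y)) (sub_nonneg.2 h3))
        nlinarith
    have hsum : S ^ 2 * ∑ y, q y * G y ≤ c * ((1 + E) * S - E * ∑ y, q y * F y) := by
      calc S ^ 2 * ∑ y, q y * G y = ∑ y, q y * (S ^ 2 * G y) := by
            rw [Finset.mul_sum]; exact Finset.sum_congr rfl fun y _ => by ring
        _ ≤ ∑ y, q y * (c * ((1 + E) * S - E * F y)) :=
            Finset.sum_le_sum fun y _ => mul_le_mul_of_nonneg_left (key y) (hq y)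
        _ = ∑ y, (c * ((1 + E) * S) * q y - c * E * (q y * F y)) :=
            Finset.sum_congr rfl fun y _ => by ring
        _ = _ := by
            rw [Finset.sum_sub_distrib, ← Finset.mul_sum, ← Finset.mul_sum, hq1]; ring
    generalize (∑ y, q y * F y) = P at *
    generalize (∑ y, q y * G y) = R at *
    rw [← mul_div_assoc, le_div_iff₀ (by positivity)]
    refine le_of_mul_le_mul_left ?_ (pow_pos hpos 2)
    have h6 : P * (S ^ 2 * R) ≤ P * (c * ((1 + E) * S - E * P)) :=
      mul_le_mul_of_nonneg_left hsum hF0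
    have h7 : 0 ≤ c * (2 * E * P - (1 + E) * S) ^ 2 := by positivity
    nlinarith

theorem sum_prod_mul_sum_prod_le {𝒴 : Type*} [Fintype 𝒴] {E : ℝ} (hE : 1 ≤ E) (n : ℕ) :
    ∀ {c : ℝ}, 0 ≤ c → ∀ (w : Fin n → 𝒴 → ℝ), (∀ i y, 0 ≤ w i y) → (∀ i, ∑ y, w i y = 1) →
    ∀ f g : (Fin n → 𝒴) → ℝ, (∀ a, 0 ≤ f a) → (∀ b, 0 ≤ g b) →
    (∀ a b, f a * g b ≤ c * ∏ i, (if a i = b i then 1 else E)) →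
    (∑ a, (∏ i, w i (a i)) * f a) * (∑ b, (∏ i, w i (b i)) * g b) ≤
      c * ((1 + E) ^ 2 / (4 * E)) ^ n := by
  induction n with
  | zero =>
    intro c hc w hw hw1 f g hf hg h
    simpa using h default default
  | succ n ih =>
    intro c hc w hw hw1 f g hf hg h
    have split : ∀ f : (Fin (n + 1) → 𝒴) → ℝ, ∑ a, (∏ i, w i (a i)) * f a =
        ∑ y, w 0 y * ∑ a : Fin n → 𝒴, (∏ i, w i.succ (a i)) * f (Fin.cons y a) := by
      intro f
      rw [← (Fin.consEquiv fun _ => 𝒴).sum_comp, Fintype.sum_prod_type]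
      refine Finset.sum_congr rfl fun y _ => ?_
      rw [Finset.mul_sum]
      refine Finset.sum_congr rfl fun a _ => ?_
      simp [Fin.consEquiv, Fin.prod_univ_succ, mul_assoc]
    have hE0 : 0 < E := by linarith
    have hK : 0 ≤ ((1 + E) ^ 2 / (4 * E)) := by positivity
    rw [split f, split g, pow_succ, ← mul_assoc]
    refine sum_mul_sum_le_of_mul_le hE (by positivity) _ _ _ (hw 0) (hw1 0) ?_ ?_
    · exact fun y => Finset.sum_nonneg fun a _ =>
        mul_nonneg (Finset.prod_nonneg fun i _ => hw _ _) (hf _)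
    · intro y z
      have := ih (c := c * (if y = z then 1 else E)) (by split_ifs <;> positivity)
        (fun i => w i.succ) (fun i => hw _) (fun i => hw1 _)
        (fun a => f (Fin.cons y a)) (fun a => g (Fin.cons z a)) (fun _ => hf _) (fun _ => hg _)
        (fun a b => by
          have := h (Fin.cons y a) (Fin.cons z b)
          rw [Fin.prod_univ_succ] at this
          simpa [mul_assoc] using this)
      refine this.trans (le_of_eq (by ring))

theorem prod_ite_eq_pow_hammingDist {𝒴 : Type*} {n : ℕ} (E : ℝ) (a b : Fin n → 𝒴) :
    ∏ i, (if a i = b i then 1 else E) = E ^ hammingDist a b := by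
  rw [Finset.prod_ite]
  simp [hammingDist]

theorem mass_mul_mass_far_le {𝒴 : Type*} [Fintype 𝒴] {n : ℕ} (w : Fin n → 𝒴 → ℝ)
    (hw : ∀ i y, 0 ≤ w i y) (hw1 : ∀ i, ∑ y, w i y = 1) (A : Finset (Fin n → 𝒴))
    {s : ℝ} (hs : 0 ≤ s) (ρ : ℝ) :
    (∑ a ∈ A, ∏ i, w i (a i)) *
      (∑ b with ∀ a ∈ A, ρ ≤ (hammingDist a b : ℝ), ∏ i, w i (b i)) * Real.exp (s * ρ) ≤
      Real.exp (n * (s ^ 2 / 4)) := by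
  have hE : 1 ≤ Real.exp s := Real.one_le_exp hs
  have h := sum_prod_mul_sum_prod_le hE n zero_le_one w hw hw1
    (fun a => if a ∈ A then 1 else 0)
    (fun b => if ∀ a ∈ A, ρ ≤ (hammingDist a b : ℝ) then Real.exp (s * ρ) else 0)
    (fun a => by positivity) (fun b => by positivity) ?_
  · simp only [mul_ite, mul_one, mul_zero, ← Finset.sum_filter, one_mul] at h
    rw [← Finset.sum_mul, ← mul_assoc] at h
    simp only [Finset.filter_mem_eq_inter, Finset.univ_inter] at h
    refine h.trans ?_
    have hcosh : (1 + Real.exp s) ^ 2 / (4 * Real.exp s) = Real.cosh (s / 2) ^ 2 := by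
      have h1 : Real.exp s = Real.exp (s / 2) ^ 2 := by
        rw [← Real.exp_nat_mul]; congr 1; push_cast; ring
      have h2 : Real.exp (s / 2) ≠ 0 := (Real.exp_pos _).ne'
      rw [Real.cosh_eq, Real.exp_neg, h1]
      field_simp
      ring
    have h3 : Real.cosh (s / 2) ^ 2 ≤ Real.exp (s ^ 2 / 4) := by
      calc Real.cosh (s / 2) ^ 2 ≤ Real.exp ((s / 2) ^ 2 / 2) ^ 2 :=
            pow_le_pow_left₀ (Real.cosh_pos _).le (Real.cosh_le_exp_half_sq _) 2
        _ = _ := by rw [← Real.exp_nat_mul]; congr 1; push_cast; ring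
    rw [hcosh, Real.exp_nat_mul]
    exact pow_le_pow_left₀ (by positivity) h3 n
  · intro a b
    rw [prod_ite_eq_pow_hammingDist, ← Real.exp_nat_mul]
    by_cases ha : a ∈ A
    · by_cases hb : ∀ a ∈ A, ρ ≤ (hammingDist a b : ℝ)
      · rw [if_pos ha, if_pos hb, one_mul, one_mul, Real.exp_le_exp, mul_comm]
        exact mul_le_mul_of_nonneg_right (hb a ha) hs
      · rw [if_neg hb]; simp [Real.exp_nonneg]
    · rw [if_neg ha]; simp [Real.exp_nonneg]

/-- The blowing-up lemma. -/
theorem mass_far_le {𝒴 : Type*} [Fintype 𝒴] {n : ℕ} (w : Fin n → 𝒴 → ℝ)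
    (hw : ∀ i y, 0 ≤ w i y) (hw1 : ∀ i, ∑ y, w i y = 1) (A : Finset (Fin n → 𝒴))
    {α : ℝ} (hα : 0 ≤ α) (hA : (2 : ℝ) ^ (-(n : ℝ) * α) ≤ ∑ a ∈ A, ∏ i, w i (a i)) :
    ∑ b with ∀ a ∈ A, n * √(2 * α * Real.log 2) ≤ (hammingDist a b : ℝ), ∏ i, w i (b i) ≤
      (2 : ℝ) ^ (-(n : ℝ) * α) := by
  set τ := √(2 * α * Real.log 2) with hτ
  have hlog : 0 < Real.log 2 := Real.log_pos (by norm_num)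
  have hτ2 : τ ^ 2 = 2 * α * Real.log 2 := Real.sq_sqrt (by positivity)
  have h := mass_mul_mass_far_le w hw hw1 A (s := 2 * τ) (by positivity) (n * τ)
  set D := ∑ b with ∀ a ∈ A, n * τ ≤ (hammingDist a b : ℝ), ∏ i, w i (b i)
  have hD : 0 ≤ D := Finset.sum_nonneg fun b _ => Finset.prod_nonneg fun i _ => hw _ _
  have heq : (2 : ℝ) ^ (-(n : ℝ) * α) = Real.exp (-(n * (τ ^ 2 / 2))) := by
    rw [Real.rpow_def_of_pos (by norm_num), hτ2]; congr 1; ring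
  rw [heq] at hA ⊢
  have h1 := mul_le_mul_of_nonneg_right (mul_le_mul_of_nonneg_right hA hD)
    (Real.exp_nonneg (2 * τ * (n * τ)))
  have h2 := h1.trans h
  refine le_of_mul_le_mul_left ?_
    (Real.exp_pos (-(n * (τ ^ 2 / 2)) + 2 * τ * (n * τ)))
  rw [← Real.exp_add (-(n * (τ ^ 2 / 2)) + 2 * τ * (n * τ)), Real.exp_add (-(n * (τ ^ 2 / 2)))]
  calc _ = Real.exp (-(n * (τ ^ 2 / 2))) * D * Real.exp (2 * τ * (n * τ)) := by ring
    _ ≤ _ := h2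
    _ = _ := by congr 1; ring

theorem card_near_le {𝒴 : Type*} [Fintype 𝒴] {n : ℕ} (A : Finset (Fin n → 𝒴))
    {l : ℝ} (hl : 0 < l) (hl1 : l ≤ 1) (ρ : ℝ) :
    ((Finset.univ.filter fun b => ∃ a ∈ A, (hammingDist a b : ℝ) ≤ ρ).card : ℝ) ≤
      A.card * (l ^ (-ρ) * (1 + Fintype.card 𝒴 * l) ^ n) := by
  have hball : ∀ a : Fin n → 𝒴,
      ((Finset.univ.filter fun b => (hammingDist a b : ℝ) ≤ ρ).card : ℝ) ≤
        l ^ (-ρ) * (1 + Fintype.card 𝒴 * l) ^ n := by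
    intro a
    have hsum : ∑ b : Fin n → 𝒴, l ^ hammingDist a b ≤ (1 + Fintype.card 𝒴 * l) ^ n := by
      simp_rw [← prod_ite_eq_pow_hammingDist]
      rw [← Fintype.prod_sum (f := fun i y => if a i = y then 1 else l)]
      calc ∏ i, ∑ y, (if a i = y then 1 else l) ≤ ∏ _i : Fin n, (1 + Fintype.card 𝒴 * l) := by
            refine Finset.prod_le_prod
              (fun i _ => Finset.sum_nonneg fun y _ => by split_ifs <;> positivity) fun i _ => ?_
            calc ∑ y, (if a i = y then 1 else l) ≤ ∑ y, ((if a i = y then 1 else 0) + l) :=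
                  Finset.sum_le_sum fun y _ => by split_ifs <;> linarith
              _ = _ := by simp [Finset.sum_add_distrib]
        _ = _ := by simp
    calc ((Finset.univ.filter fun b => (hammingDist a b : ℝ) ≤ ρ).card : ℝ)
        = ∑ b with (hammingDist a b : ℝ) ≤ ρ, (1 : ℝ) := by simp
      _ ≤ ∑ b with (hammingDist a b : ℝ) ≤ ρ, l ^ (-ρ) * l ^ hammingDist a b := by
          refine Finset.sum_le_sum fun b hb => ?_
          rw [← Real.rpow_natCast l, ← Real.rpow_add hl]
          exact Real.one_le_rpow_of_pos_of_le_one_of_nonpos hl hl1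
            (by linarith [(Finset.mem_filter.1 hb).2])
      _ ≤ ∑ b, l ^ (-ρ) * l ^ hammingDist a b :=
          Finset.sum_le_sum_of_subset_of_nonneg (Finset.filter_subset _ _)
            fun b _ _ => by positivity
      _ ≤ _ := by
          rw [← Finset.mul_sum]
          exact mul_le_mul_of_nonneg_left hsum (by positivity)
  have hsub : (Finset.univ.filter fun b => ∃ a ∈ A, (hammingDist a b : ℝ) ≤ ρ) ⊆
      A.biUnion fun a => Finset.univ.filter fun b => (hammingDist a b : ℝ) ≤ ρ := by
    intro b hb
    simpa using hb
  calc _ ≤ ((A.biUnion fun a =>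
          Finset.univ.filter fun b => (hammingDist a b : ℝ) ≤ ρ).card : ℝ) := by
        exact_mod_cast Finset.card_le_card hsub
    _ ≤ ∑ a ∈ A, ((Finset.univ.filter fun b => (hammingDist a b : ℝ) ≤ ρ).card : ℝ) := by
        exact_mod_cast Finset.card_biUnion_le
    _ ≤ ∑ a ∈ A, l ^ (-ρ) * (1 + Fintype.card 𝒴 * l) ^ n :=
        Finset.sum_le_sum fun a _ => hball a
    _ = _ := by simp

theorem card_near_le_rpow {𝒴 : Type*} [Fintype 𝒴] {n : ℕ} (A : Finset (Fin n → 𝒴))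
    {α : ℝ} (hα : 0 < α) (hα1 : α < 1) :
    ((Finset.univ.filter fun b => ∃ a ∈ A,
      (hammingDist a b : ℝ) ≤ n * √(2 * α * Real.log 2)).card : ℝ) ≤
      A.card * 2 ^ (n * √α * (-Real.logb 2 α + 2 * Fintype.card 𝒴)) := by
  have hlog : 0 < Real.log 2 := Real.log_pos (by norm_num)
  have hs : 0 < √α := Real.sqrt_pos.2 hα
  have hs1 : √α ≤ 1 := Real.sqrt_le_one.2 hα1.le
  refine (card_near_le A hs hs1 _).trans (mul_le_mul_of_nonneg_left ?_ (Nat.cast_nonneg _))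
  have h1 : (1 + Fintype.card 𝒴 * √α) ^ n ≤ Real.exp (n * (Fintype.card 𝒴 * √α)) := by
    rw [Real.exp_nat_mul]
    exact pow_le_pow_left₀ (by positivity) (by linarith [Real.add_one_le_exp (Fintype.card 𝒴 * √α)]) n
  have hlog2 : 1 / 2 ≤ Real.log 2 := by linarith [Real.log_two_gt_d9]
  have hlog2' : Real.log 2 ≤ 1 := by linarith [Real.log_two_lt_d9]
  have hlα : Real.log α < 0 := Real.log_neg hα hα1
  have hsq : √(2 * α * Real.log 2) ≤ 2 * √α := by
    rw [show 2 * √α = √(4 * α) by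
      rw [Real.sqrt_mul (by norm_num), show (4 : ℝ) = 2 ^ 2 by norm_num, Real.sqrt_sq (by norm_num)]]
    exact Real.sqrt_le_sqrt (by nlinarith)
  calc _ ≤ √α ^ (-(n * √(2 * α * Real.log 2))) * Real.exp (n * (Fintype.card 𝒴 * √α)) :=
        mul_le_mul_of_nonneg_left h1 (by positivity)
    _ = Real.exp (n * √(2 * α * Real.log 2) * (-(Real.log α) / 2)
          + n * (Fintype.card 𝒴 * √α)) := by
        rw [Real.rpow_def_of_pos hs, ← Real.exp_add, Real.log_sqrt hα.le]; congr 1; ring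
    _ ≤ Real.exp (Real.log 2 * (n * √α * (-Real.logb 2 α + 2 * Fintype.card 𝒴))) := by
        rw [Real.exp_le_exp]
        have e1 : Real.log 2 * (n * √α * (-Real.logb 2 α + 2 * Fintype.card 𝒴)) =
            n * (2 * √α) * (-(Real.log α) / 2) +
              n * (Fintype.card 𝒴 * √α) * (2 * Real.log 2) := by
          rw [Real.logb]; field_simp
        rw [e1]
        have e2 : n * √(2 * α * Real.log 2) * (-(Real.log α) / 2) ≤
            n * (2 * √α) * (-(Real.log α) / 2) :=
          mul_le_mul_of_nonneg_right (mul_le_mul_of_nonneg_left hsq (Nat.cast_nonneg _))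
            (by linarith)
        have e3 : n * (Fintype.card 𝒴 * √α) * 1 ≤ n * (Fintype.card 𝒴 * √α) * (2 * Real.log 2) :=
          mul_le_mul_of_nonneg_left (by linarith) (by positivity)
        linarith
    _ = _ := (Real.rpow_def_of_pos (by norm_num) _).symm

theorem sum_mul_neg_logb_le {T 𝓑 : Type*} [Fintype T] [Nonempty T] [Fintype 𝓑]
    (p : 𝓑 → T → ℝ) (hp : ∀ m y, 0 ≤ p m y) (hp1 : ∑ m, ∑ y, p m y = 1) (S : Finset (𝓑 × T)) :
    ∑ z ∈ S, p z.1 z.2 * -Real.logb 2 (p z.1 z.2 / ∑ y, p z.1 y) ≤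
      (∑ z ∈ S, p z.1 z.2) * Real.logb 2 (Fintype.card T) + 2 := by
  have hlog : 0 < Real.log 2 := Real.log_pos (by norm_num)
  have hT : (0 : ℝ) < Fintype.card T := by exact_mod_cast Fintype.card_pos
  have hpm : ∀ m, 0 ≤ ∑ y, p m y := fun m => Finset.sum_nonneg fun y _ => hp m y
  have hle : ∀ m y, p m y ≤ ∑ y, p m y := fun m y =>
    Finset.single_le_sum (fun y _ => hp m y) (Finset.mem_univ y)
  have key : ∀ z : 𝓑 × T, p z.1 z.2 * -Real.logb 2 (p z.1 z.2 / ∑ y, p z.1 y) ≤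
      p z.1 z.2 * Real.logb 2 (Fintype.card T) +
        (∑ y, p z.1 y) * ((Fintype.card T : ℝ)⁻¹ * 2) := by
    rintro ⟨m, y⟩
    dsimp only
    have hm := hpm m
    rcases (hp m y).eq_or_lt with h0 | h0
    · rw [← h0, zero_mul, zero_mul, zero_add]; positivity
    · have hmpos : 0 < ∑ y, p m y := h0.trans_le (hle m y)
      set s := ∑ y, p m y
      have h1 : Real.log (s / (p m y * Fintype.card T)) ≤ s / (p m y * Fintype.card T) := by
        linarith [Real.log_le_sub_one_of_pos (x := s / (p m y * Fintype.card T)) (by positivity)]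
      rw [Real.log_div hmpos.ne' (by positivity), Real.log_mul h0.ne' hT.ne'] at h1
      have h2 : p m y * (Real.log s - (Real.log (p m y) + Real.log (Fintype.card T))) ≤
          s * (Fintype.card T : ℝ)⁻¹ := by
        calc _ ≤ p m y * (s / (p m y * Fintype.card T)) := mul_le_mul_of_nonneg_left h1 h0.le
          _ = _ := by field_simp
      have h3 : 0 ≤ s * (Fintype.card T : ℝ)⁻¹ := by positivity
      rw [Real.logb, Real.logb, Real.log_div h0.ne' hmpos.ne']
      refine le_of_mul_le_mul_right ?_ hlog
      have e1 : p m y * -((Real.log (p m y) - Real.log s) / Real.log 2) * Real.log 2 =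
          p m y * (Real.log s - Real.log (p m y)) := by field_simp; ring
      have e2 : (p m y * (Real.log (Fintype.card T) / Real.log 2) +
          s * ((Fintype.card T : ℝ)⁻¹ * 2)) * Real.log 2 =
          p m y * Real.log (Fintype.card T) + s * (Fintype.card T : ℝ)⁻¹ * (2 * Real.log 2) := by
        field_simp
      rw [e1, e2]
      have h4 : s * (Fintype.card T : ℝ)⁻¹ * 1 ≤ s * (Fintype.card T : ℝ)⁻¹ * (2 * Real.log 2) :=
        mul_le_mul_of_nonneg_left (by linarith [Real.log_two_gt_d9]) h3
      linarith
  calc _ ≤ ∑ z ∈ S, (p z.1 z.2 * Real.logb 2 (Fintype.card T) +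
        (∑ y, p z.1 y) * ((Fintype.card T : ℝ)⁻¹ * 2)) := Finset.sum_le_sum fun z _ => key z
    _ ≤ (∑ z ∈ S, p z.1 z.2) * Real.logb 2 (Fintype.card T) +
        ∑ z : 𝓑 × T, (∑ y, p z.1 y) * ((Fintype.card T : ℝ)⁻¹ * 2) := by
      rw [Finset.sum_add_distrib, Finset.sum_mul]
      gcongr
      · exact fun z _ _ => mul_nonneg (hpm _) (by positivity)
      · exact Finset.subset_univ S
    _ = _ := by
      have h : ∀ m, ∑ _y : T, (∑ y, p m y) * ((Fintype.card T : ℝ)⁻¹ * 2) =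
          (∑ y, p m y) * 2 := fun m => by
        rw [Finset.sum_const, Finset.card_univ, nsmul_eq_mul]
        field_simp
      rw [Fintype.sum_prod_type]
      simp_rw [h]
      rw [← Finset.sum_mul, hp1, one_mul]

theorem abs_sub_entropy_le {T 𝓑 : Type*} [Fintype T] [Nonempty T] [Fintype 𝓑]
    (p : 𝓑 → T → ℝ) (hp : ∀ m y, 0 ≤ p m y) (hp1 : ∑ m, ∑ y, p m y = 1) (B : Finset (𝓑 × T))
    {κ lo hi : ℝ} (hB : ∑ z ∈ B, p z.1 z.2 ≤ 1 / 2)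
    (hκ : (∑ z ∈ B, p z.1 z.2) * Real.logb 2 (Fintype.card T) ≤ κ) (hhi0 : 0 ≤ hi)
    (hlo : ∀ z ∉ B, lo ≤ -Real.logb 2 (p z.1 z.2 / ∑ y, p z.1 y))
    (hhi : ∀ z ∉ B, -Real.logb 2 (p z.1 z.2 / ∑ y, p z.1 y) ≤ hi) :
    ∀ z ∉ B, |-Real.logb 2 (p z.1 z.2 / ∑ y, p z.1 y) -
      ∑ z : 𝓑 × T, p z.1 z.2 * -Real.logb 2 (p z.1 z.2 / ∑ y, p z.1 y)| ≤
        hi - lo + 2 * κ + 2 := by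
  have hmass : ∀ S : Finset (𝓑 × T), 0 ≤ ∑ z ∈ S, p z.1 z.2 := fun S =>
    Finset.sum_nonneg fun z _ => hp _ _
  have hall : ∑ z : 𝓑 × T, p z.1 z.2 = 1 := by rw [Fintype.sum_prod_type, hp1]
  have hcompl := Finset.sum_add_sum_compl B fun z : 𝓑 × T => p z.1 z.2
  rw [hall] at hcompl
  have hL : 0 ≤ Real.logb 2 (Fintype.card T) :=
    Real.logb_nonneg (by norm_num) (by exact_mod_cast Fintype.card_pos)
  set h : 𝓑 × T → ℝ := fun z => -Real.logb 2 (p z.1 z.2 / ∑ y, p z.1 y) with hdef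
  have h0 : ∀ z, 0 ≤ h z := fun z => by
    rw [hdef, Left.nonneg_neg_iff]
    exact Real.logb_nonpos (by norm_num)
      (div_nonneg (hp _ _) (Finset.sum_nonneg fun y _ => hp _ _))
      (div_le_one_of_le₀ (Finset.single_le_sum (fun y _ => hp z.1 y) (Finset.mem_univ z.2))
        (Finset.sum_nonneg fun y _ => hp _ _))
  have hsplit := Finset.sum_add_sum_compl B fun z : 𝓑 × T => p z.1 z.2 * h z
  have hbad := sum_mul_neg_logb_le p hp hp1 B
  have htot := sum_mul_neg_logb_le p hp hp1 Finset.univ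
  rw [hall, one_mul] at htot
  change ∑ z ∈ B, p z.1 z.2 * h z ≤ _ at hbad
  change ∑ z : 𝓑 × T, p z.1 z.2 * h z ≤ _ at htot
  change ∀ z ∉ B, |h z - ∑ z : 𝓑 × T, p z.1 z.2 * h z| ≤ _
  have hbad0 : 0 ≤ ∑ z ∈ B, p z.1 z.2 * h z :=
    Finset.sum_nonneg fun z _ => mul_nonneg (hp _ _) (h0 z)
  have hgood_hi : ∑ z ∈ Bᶜ, p z.1 z.2 * h z ≤ (∑ z ∈ Bᶜ, p z.1 z.2) * hi := by
    rw [Finset.sum_mul]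
    exact Finset.sum_le_sum fun z hz =>
      mul_le_mul_of_nonneg_left (hhi z (Finset.mem_compl.1 hz)) (hp _ _)
  have hgood_lo : (∑ z ∈ Bᶜ, p z.1 z.2) * lo ≤ ∑ z ∈ Bᶜ, p z.1 z.2 * h z := by
    rw [Finset.sum_mul]
    exact Finset.sum_le_sum fun z hz =>
      mul_le_mul_of_nonneg_left (hlo z (Finset.mem_compl.1 hz)) (hp _ _)
  have hB0 := hmass B
  have hBc0 := hmass Bᶜ
  intro z hz
  have hz1 : lo ≤ h z := hlo z hz
  have hz2 : h z ≤ hi := hhi z hz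
  generalize (∑ z : 𝓑 × T, p z.1 z.2 * h z) = H at *
  generalize (∑ z ∈ B, p z.1 z.2 * h z) = HB at *
  generalize (∑ z ∈ Bᶜ, p z.1 z.2 * h z) = HG at *
  generalize (∑ z ∈ B, p z.1 z.2) = e at *
  generalize (∑ z ∈ Bᶜ, p z.1 z.2) = g at *
  have hκ0 : 0 ≤ κ := le_trans (by positivity) hκ
  have hup : H ≤ hi + κ + 2 := by nlinarith
  have hdown : lo ≤ H + 2 * κ + 2 := by
    rcases le_total lo 0 with hl | hl
    · nlinarith
    · have h1 : lo ≤ 2 * (Real.logb 2 (Fintype.card T) + 2) := by nlinarith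
      have h2 := mul_le_mul_of_nonneg_left h1 hB0
      nlinarith
  rw [abs_le]
  constructor <;> linarith

theorem sum_mixture_le {𝒜 𝓑 T : Type*} [Fintype 𝒜] [Fintype 𝓑] [Fintype T]
    (r : 𝒜 → 𝓑 → ℝ) (hr : ∀ x m, 0 ≤ r x m) (hr1 : ∑ m, ∑ x, r x m = 1)
    (Q : 𝒜 → T → ℝ) (p : 𝓑 → T → ℝ) (hp : ∀ m y, p m y = ∑ x, r x m * Q x y)
    {ε : ℝ} (D : 𝓑 × T → Prop) [DecidablePred D]
    (hD : ∀ x m, 0 < r x m → ∑ y with D (m, y), Q x y ≤ ε) :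
    ∑ z with D z, p z.1 z.2 ≤ ε := by
  calc ∑ z with D z, p z.1 z.2
      = ∑ m, ∑ x, r x m * ∑ y with D (m, y), Q x y := by
        rw [Finset.sum_filter, Fintype.sum_prod_type]
        refine Finset.sum_congr rfl fun m _ => ?_
        simp_rw [hp, Finset.mul_sum]
        rw [Finset.sum_comm, Finset.sum_filter]
    _ ≤ ∑ m, ∑ x, r x m * ε := by
        refine Finset.sum_le_sum fun m _ => Finset.sum_le_sum fun x _ => ?_
        rcases (hr x m).eq_or_lt with h | h
        · rw [← h, zero_mul, zero_mul]
        · exact mul_le_mul_of_nonneg_left (hD x m h) h.le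
    _ = ε := by simp_rw [← Finset.sum_mul]; rw [hr1, one_mul]

theorem sum_filter_or_le {ι : Type*} [Fintype ι] (p : ι → ℝ) (hp : ∀ i, 0 ≤ p i)
    (P Q : ι → Prop) [DecidablePred P] [DecidablePred Q] [DecidablePred fun i => P i ∨ Q i] :
    ∑ i with P i ∨ Q i, p i ≤ ∑ i with P i, p i + ∑ i with Q i, p i := by
  simp_rw [Finset.sum_filter]
  rw [← Finset.sum_add_distrib]
  refine Finset.sum_le_sum fun i _ => ?_
  have := hp i
  by_cases h1 : P i <;> by_cases h2 : Q i <;> simp [h1, h2, this]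

/-- Outside a set of small probability, the conditional entropy spectrum of a mixture of product
measures, all of whose components have the same image size index `t` relative to the reference
law `p₀`, is confined to an interval around `t`. -/
theorem exists_spectrum_bounds {𝒜 𝓑 𝒴 : Type*} [Fintype 𝒜] [Fintype 𝓑] [Fintype 𝒴]
    {n : ℕ} {α : ℝ} (hα0 : 0 < α) (hα1 : α < 1)
    (r : 𝒜 → 𝓑 → ℝ) (hr : ∀ x m, 0 ≤ r x m) (hr1 : ∑ m, ∑ x, r x m = 1)
    (w : 𝒜 → Fin n → 𝒴 → ℝ) (hw : ∀ x i y, 0 ≤ w x i y) (hw1 : ∀ x i, ∑ y, w x i y = 1)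
    (p : 𝓑 → (Fin n → 𝒴) → ℝ) (hpdef : ∀ m y, p m y = ∑ x, r x m * ∏ i, w x i (y i))
    (hp : ∀ m y, 0 ≤ p m y) (hp1 : ∑ m, ∑ y, p m y = 1)
    (p₀ : 𝓑 → (Fin n → 𝒴) → ℝ) (hp₀ : ∀ m y, 0 ≤ p₀ m y) (hp₀1 : ∑ m, ∑ y, p₀ m y = 1)
    {π : ℝ} (hπ : 0 < π) (hπ1 : π ≤ 1) (hpp₀ : ∀ m y, π * p m y ≤ p₀ m y) (t : ℕ)
    (ht : ∀ x m, 0 < r x m → (2 : ℝ) ^ (-(n : ℝ) * α) ≤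
      ∑ y with ∑ y', p₀ m y' ≤ 2 ^ t * p₀ m y, ∏ i, w x i (y i))
    (ht' : ∀ s, t = s + 1 → ∀ x m, 0 < r x m →
      ∑ y with ∑ y', p₀ m y' ≤ 2 ^ s * p₀ m y, ∏ i, w x i (y i) ≤ (2 : ℝ) ^ (-(n : ℝ) * α)) :
    ∃ B : Finset (𝓑 × (Fin n → 𝒴)),
      ∑ z ∈ B, p z.1 z.2 ≤ 7 / 2 * (2 : ℝ) ^ (-(n : ℝ) * α) ∧
      (∀ z ∉ B, t - 1 - n * α - -Real.logb 2 π ≤ -Real.logb 2 (p z.1 z.2 / ∑ y, p z.1 y)) ∧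
      ∀ z ∉ B, -Real.logb 2 (p z.1 z.2 / ∑ y, p z.1 y) ≤
        t + 1 + n * √α * (-Real.logb 2 α + 2 * Fintype.card 𝒴) + n * α := by
  set ε := (2 : ℝ) ^ (-(n : ℝ) * α) with hεdef
  have hε0 : 0 < ε := by positivity
  set β := n * √α * (-Real.logb 2 α + 2 * Fintype.card 𝒴) with hβdef
  set η := -Real.logb 2 π with hηdef
  have hη0 : 0 ≤ η := by
    rw [hηdef, Left.nonneg_neg_iff]; exact Real.logb_nonpos (by norm_num) hπ.le hπ1
  have hQ : ∀ x (y : Fin n → 𝒴), 0 ≤ ∏ i, w x i (y i) := fun x y =>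
    Finset.prod_nonneg fun i _ => hw _ _ _
  have hple : ∀ m y, p m y ≤ ∑ y, p m y := fun m y =>
    Finset.single_le_sum (fun y _ => hp m y) (Finset.mem_univ y)
  set A : 𝓑 → Finset (Fin n → 𝒴) := fun m =>
    Finset.univ.filter fun y => ∑ y', p₀ m y' ≤ 2 ^ t * p₀ m y with hA
  set N : 𝓑 → Finset (Fin n → 𝒴) := fun m =>
    Finset.univ.filter fun b => ∃ a ∈ A m,
      (hammingDist a b : ℝ) ≤ n * √(2 * α * Real.log 2) with hN
  have hpmP : ∀ m, π * ∑ y, p m y ≤ ∑ y, p₀ m y := fun m => by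
    rw [Finset.mul_sum]; exact Finset.sum_le_sum fun y _ => hpp₀ m y
  have hNcard : ∀ m, 0 < ∑ y, p m y → ((N m).card : ℝ) ≤ 2 ^ t * 2 ^ β := by
    intro m hm
    have hP : 0 < ∑ y, p₀ m y := lt_of_lt_of_le (by positivity) (hpmP m)
    refine (card_near_le_rpow (A m) hα0 hα1).trans
      (mul_le_mul_of_nonneg_right ?_ (by positivity))
    refine le_of_mul_le_mul_right ?_ hP
    calc ((A m).card : ℝ) * ∑ y, p₀ m y = ∑ y ∈ A m, ∑ y', p₀ m y' := by simp
      _ ≤ ∑ y ∈ A m, 2 ^ t * p₀ m y :=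
          Finset.sum_le_sum fun y hy => (Finset.mem_filter.1 hy).2
      _ ≤ ∑ y, 2 ^ t * p₀ m y :=
          Finset.sum_le_sum_of_subset_of_nonneg (Finset.subset_univ _)
            fun y _ _ => mul_nonneg (by positivity) (hp₀ m y)
      _ = _ := by rw [Finset.mul_sum]
  set B0 : 𝓑 × (Fin n → 𝒴) → Prop := fun z => p z.1 z.2 = 0 with hB0
  set B1 : 𝓑 × (Fin n → 𝒴) → Prop := fun z => ∑ y, p z.1 y ≤ ε * ∑ y, p₀ z.1 y with hB1
  set B2 : 𝓑 × (Fin n → 𝒴) → Prop := fun z =>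
    ∃ s, t = s + 1 ∧ ∑ y', p₀ z.1 y' ≤ 2 ^ s * p₀ z.1 z.2 with hB2
  set B3 : 𝓑 × (Fin n → 𝒴) → Prop := fun z => z.2 ∉ N z.1 with hB3
  set B4 : 𝓑 × (Fin n → 𝒴) → Prop := fun z => z.2 ∈ N z.1 ∧
    2 * (2 ^ t * 2 ^ β) * p z.1 z.2 ≤ ε * ∑ y, p z.1 y with hB4
  have m0 : ∑ z with B0 z, p z.1 z.2 = 0 :=
    Finset.sum_eq_zero fun z hz => (Finset.mem_filter.1 hz).2
  have m1 : ∑ z with B1 z, p z.1 z.2 ≤ ε := by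
    calc ∑ z with B1 z, p z.1 z.2 = ∑ m, if ∑ y, p m y ≤ ε * ∑ y, p₀ m y then ∑ y, p m y else 0 := by
          rw [Finset.sum_filter, Fintype.sum_prod_type]
          refine Finset.sum_congr rfl fun m _ => ?_
          by_cases h : ∑ y, p m y ≤ ε * ∑ y, p₀ m y <;> simp [hB1, h]
      _ ≤ ∑ m, ε * ∑ y, p₀ m y := by
          refine Finset.sum_le_sum fun m _ => ?_
          split_ifs with h
          · exact h
          · exact mul_nonneg hε0.le (Finset.sum_nonneg fun y _ => hp₀ m y)
      _ = ε := by rw [← Finset.mul_sum, hp₀1, mul_one]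
  have m2 : ∑ z with B2 z, p z.1 z.2 ≤ ε := by
    refine sum_mixture_le r hr hr1 (fun x y => ∏ i, w x i (y i)) p hpdef B2 fun x m hx => ?_
    rcases hts : t with _ | s
    · rw [Finset.sum_eq_zero]
      · exact hε0.le
      · intro y hy
        obtain ⟨s, hs, -⟩ := (Finset.mem_filter.1 hy).2
        omega
    · refine le_trans (Finset.sum_le_sum_of_subset_of_nonneg ?_ fun y _ _ => hQ x y)
        (ht' s hts x m hx)
      intro y hy
      obtain ⟨s', hs', hy'⟩ := (Finset.mem_filter.1 hy).2
      obtain rfl : s' = s := by omega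
      exact Finset.mem_filter.2 ⟨Finset.mem_univ _, hy'⟩
  have m3 : ∑ z with B3 z, p z.1 z.2 ≤ ε := by
    refine sum_mixture_le r hr hr1 (fun x y => ∏ i, w x i (y i)) p hpdef B3 fun x m hx => ?_
    refine le_trans (Finset.sum_le_sum_of_subset_of_nonneg ?_ fun y _ _ => hQ x y)
      (mass_far_le (w x) (hw x) (hw1 x) (A m) hα0.le (ht x m hx))
    intro y hy
    have hy' : y ∉ N m := (Finset.mem_filter.1 hy).2
    simp only [hN, Finset.mem_filter, Finset.mem_univ, true_and, not_exists, not_and,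
      not_le] at hy' ⊢
    exact fun a ha => (hy' a ha).le
  have m4 : ∑ z with B4 z, p z.1 z.2 ≤ ε / 2 := by
    calc ∑ z with B4 z, p z.1 z.2
        = ∑ m, ∑ y with y ∈ N m ∧ 2 * (2 ^ t * 2 ^ β) * p m y ≤ ε * ∑ y, p m y, p m y := by
          rw [Finset.sum_filter, Fintype.sum_prod_type]
          exact Finset.sum_congr rfl fun m _ => (Finset.sum_filter _ _).symm
      _ ≤ ∑ m, ε / 2 * ∑ y, p m y := by
          refine Finset.sum_le_sum fun m _ => ?_
          rcases (Finset.sum_nonneg fun y _ => hp m y).eq_or_lt with h | h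
          · have : ∀ y, p m y = 0 := fun y => le_antisymm (by rw [h]; exact hple m y) (hp m y)
            simp [this]
          · set D := Finset.univ.filter fun y =>
              y ∈ N m ∧ 2 * (2 ^ t * 2 ^ β) * p m y ≤ ε * ∑ y, p m y
            have hDc : (D.card : ℝ) ≤ 2 ^ t * 2 ^ β := by
              refine le_trans ?_ (hNcard m h)
              have hDN : D ⊆ N m := fun y hy => (Finset.mem_filter.1 hy).2.1
              exact_mod_cast Finset.card_le_card hDN
            have hK : (0 : ℝ) < 2 ^ t * 2 ^ β := by positivity
            refine le_of_mul_le_mul_left ?_ (mul_pos two_pos hK)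
            calc 2 * (2 ^ t * 2 ^ β) * ∑ y ∈ D, p m y
                = ∑ y ∈ D, 2 * (2 ^ t * 2 ^ β) * p m y := Finset.mul_sum _ _ _
              _ ≤ ∑ y ∈ D, ε * ∑ y, p m y :=
                  Finset.sum_le_sum fun y hy => (Finset.mem_filter.1 hy).2.2
              _ = D.card * (ε * ∑ y, p m y) := by simp
              _ ≤ 2 ^ t * 2 ^ β * (ε * ∑ y, p m y) :=
                  mul_le_mul_of_nonneg_right hDc (by positivity)
              _ = _ := by ring
      _ = ε / 2 := by rw [← Finset.mul_sum, hp1, mul_one]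
  set Bad : Finset (𝓑 × (Fin n → 𝒴)) :=
    Finset.univ.filter fun z => B0 z ∨ B1 z ∨ B2 z ∨ B3 z ∨ B4 z with hBad
  have hpz : ∀ z : 𝓑 × (Fin n → 𝒴), 0 ≤ p z.1 z.2 := fun z => hp _ _
  have hBadm : ∑ z ∈ Bad, p z.1 z.2 ≤ 7 / 2 * ε := by
    have q0 := sum_filter_or_le (fun z : 𝓑 × (Fin n → 𝒴) => p z.1 z.2) hpz B0
      (fun z => B1 z ∨ B2 z ∨ B3 z ∨ B4 z)
    have q1 := sum_filter_or_le (fun z : 𝓑 × (Fin n → 𝒴) => p z.1 z.2) hpz B1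
      (fun z => B2 z ∨ B3 z ∨ B4 z)
    have q2 := sum_filter_or_le (fun z : 𝓑 × (Fin n → 𝒴) => p z.1 z.2) hpz B2
      (fun z => B3 z ∨ B4 z)
    have q3 := sum_filter_or_le (fun z : 𝓑 × (Fin n → 𝒴) => p z.1 z.2) hpz B3 B4
    rw [hBad]
    linarith
  refine ⟨Bad, hBadm, ?_, ?_⟩
  · intro z hz
    simp only [hBad, Finset.mem_filter, Finset.mem_univ, true_and, not_or] at hz
    obtain ⟨z0, z1, z2, -, -⟩ := hz
    obtain ⟨m, y⟩ := z
    simp only [hB0, hB1, hB2, not_le, not_exists, not_and] at z0 z1 z2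
    have hpos : 0 < p m y := lt_of_le_of_ne (hp m y) (Ne.symm z0)
    have hs : 0 < ∑ y, p m y := hpos.trans_le (hple m y)
    have hP : 0 < ∑ y, p₀ m y := lt_of_lt_of_le (by positivity) (hpmP m)
    dsimp only
    rcases t with _ | s
    · have : Real.logb 2 (p m y / ∑ y, p m y) ≤ 0 :=
        Real.logb_nonpos (by norm_num) (by positivity) (div_le_one_of_le₀ (hple m y) hs.le)
      have h3 : (0 : ℝ) ≤ n * α := by positivity
      push_cast
      linarith
    · have h1 := z2 s rfl
      have h2 : p m y / ∑ y, p m y ≤ 2 ^ (-(s : ℝ) + n * α + η) := by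
        rw [div_le_iff₀ hs]
        have e : (2 : ℝ) ^ (-(s : ℝ) + n * α + η) = 1 / (2 ^ s * ε * π) := by
          rw [Real.rpow_add two_pos, Real.rpow_add two_pos, hεdef, hηdef, neg_mul,
            Real.rpow_neg two_pos.le, Real.rpow_neg two_pos.le, Real.rpow_neg two_pos.le,
            Real.rpow_logb two_pos (by norm_num) hπ, Real.rpow_natCast]
          field_simp
        rw [e, div_mul_eq_mul_div, le_div_iff₀ (by positivity), one_mul]
        calc p m y * (2 ^ s * ε * π) = ε * (2 ^ s * (π * p m y)) := by ring
          _ ≤ ε * (2 ^ s * p₀ m y) := by gcongr; exact hpp₀ m y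
          _ ≤ ε * ∑ y, p₀ m y := by gcongr
          _ ≤ _ := z1.le
      have h3 := (Real.logb_le_iff_le_rpow (b := 2) (by norm_num) (div_pos hpos hs)).2 h2
      push_cast
      linarith
  · intro z hz
    simp only [hBad, Finset.mem_filter, Finset.mem_univ, true_and, not_or] at hz
    obtain ⟨z0, -, -, z3, z4⟩ := hz
    obtain ⟨m, y⟩ := z
    simp only [hB0, hB3, hB4, not_le, not_and, not_not] at z0 z3 z4
    have hpos : 0 < p m y := lt_of_le_of_ne (hp m y) (Ne.symm z0)
    have hs : 0 < ∑ y, p m y := hpos.trans_le (hple m y)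
    dsimp only
    have h2 : (2 : ℝ) ^ (-(t : ℝ) - 1 - β - n * α) ≤ p m y / ∑ y, p m y := by
      rw [le_div_iff₀ hs]
      have e : (2 : ℝ) ^ (-(t : ℝ) - 1 - β - n * α) = ε / (2 * (2 ^ t * 2 ^ β)) := by
        rw [hεdef, show -(t : ℝ) - 1 - β - n * α = -(n : ℝ) * α - (1 + (t + β)) by ring,
          Real.rpow_sub two_pos, Real.rpow_add two_pos, Real.rpow_add two_pos, Real.rpow_one,
          Real.rpow_natCast]
      rw [e, div_mul_eq_mul_div, div_le_iff₀ (by positivity), mul_comm (p m y)]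
      exact (z4 z3).le
    have h3 := (Real.le_logb_iff_rpow_le (b := 2) (by norm_num) (div_pos hpos hs)).2 h2
    linarith

/-- Concentration of the conditional entropy spectrum of a mixture of product measures, all of
whose components have the same image size index `t` relative to the reference law `p₀`. -/
theorem mixture_concentration {𝒜 𝓑 𝒴 : Type*} [Fintype 𝒜] [Fintype 𝓑] [Fintype 𝒴]
    (hc : 2 ≤ Fintype.card 𝒴) {n : ℕ} (hn : 27 ≤ n) {α : ℝ}
    (hα : Real.logb 2 n / n < α) (hα1 : α < 1 / (8 * Real.log 2))
    (r : 𝒜 → 𝓑 → ℝ) (hr : ∀ x m, 0 ≤ r x m) (hr1 : ∑ m, ∑ x, r x m = 1)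
    (w : 𝒜 → Fin n → 𝒴 → ℝ) (hw : ∀ x i y, 0 ≤ w x i y) (hw1 : ∀ x i, ∑ y, w x i y = 1)
    (p : 𝓑 → (Fin n → 𝒴) → ℝ) (hpdef : ∀ m y, p m y = ∑ x, r x m * ∏ i, w x i (y i))
    (p₀ : 𝓑 → (Fin n → 𝒴) → ℝ) (hp₀ : ∀ m y, 0 ≤ p₀ m y) (hp₀1 : ∑ m, ∑ y, p₀ m y = 1)
    {π : ℝ} (hπ : 0 < π) (hπ1 : π ≤ 1) (hpp₀ : ∀ m y, π * p m y ≤ p₀ m y) (t : ℕ)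
    (ht : ∀ x m, 0 < r x m → (2 : ℝ) ^ (-(n : ℝ) * α) ≤
      ∑ y with ∑ y', p₀ m y' ≤ 2 ^ t * p₀ m y, ∏ i, w x i (y i))
    (ht' : ∀ s, t = s + 1 → ∀ x m, 0 < r x m →
      ∑ y with ∑ y', p₀ m y' ≤ 2 ^ s * p₀ m y, ∏ i, w x i (y i) ≤ (2 : ℝ) ^ (-(n : ℝ) * α)) :
    ∑ z : 𝓑 × (Fin n → 𝒴) with
      n * ((1 + 16 * Fintype.card 𝒴) * √α * (-Real.logb 2 α)) + 3 * (-Real.logb 2 π) <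
        |-Real.logb 2 (p z.1 z.2 / ∑ y, p z.1 y) -
          ∑ z : 𝓑 × (Fin n → 𝒴), p z.1 z.2 * -Real.logb 2 (p z.1 z.2 / ∑ y, p z.1 y)|,
      p z.1 z.2 < 4 * (2 : ℝ) ^ (-(n : ℝ) * α) := by
  have hlog : 0 < Real.log 2 := Real.log_pos (by norm_num)
  have hn' : (27 : ℝ) ≤ n := by exact_mod_cast hn
  have hn0 : (0 : ℝ) < n := by linarith
  have hc' : (2 : ℝ) ≤ Fintype.card 𝒴 := by exact_mod_cast hc
  have : Nonempty 𝒴 := Fintype.card_pos_iff.1 (by omega)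
  have hnα : Real.logb 2 n < n * α := by rw [div_lt_iff₀ hn0] at hα; linarith
  have hlogn : 1 ≤ Real.logb 2 n := by
    rw [Real.le_logb_iff_rpow_le (by norm_num) hn0, Real.rpow_one]; linarith
  have hα0 : 0 < α := by
    by_contra hcon
    have : (n : ℝ) * α ≤ 0 := mul_nonpos_of_nonneg_of_nonpos hn0.le (not_lt.1 hcon)
    linarith
  have hα2 : α ≤ 1 / 2 := by
    refine hα1.le.trans ?_
    rw [div_le_div_iff₀ (by positivity) (by norm_num)]
    linarith [Real.log_two_gt_d9]
  set ℓ := -Real.logb 2 α with hℓdef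
  have hℓ : 1 ≤ ℓ := by
    have : Real.logb 2 α ≤ -1 := by
      rw [Real.logb_le_iff_le_rpow (by norm_num) hα0, Real.rpow_neg_one]; linarith
    linarith
  set ε := (2 : ℝ) ^ (-(n : ℝ) * α) with hεdef
  have hε0 : 0 < ε := by positivity
  have hεn : ε * n ≤ 1 := by
    have : (n : ℝ) ≤ 2 ^ ((n : ℝ) * α) := by
      rw [← Real.logb_le_iff_le_rpow (by norm_num) hn0]; exact hnα.le
    rw [hεdef, neg_mul, Real.rpow_neg (by norm_num), inv_mul_le_iff₀ (by positivity), mul_one]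
    exact this
  set β := n * √α * (ℓ + 2 * Fintype.card 𝒴) with hβdef
  have hs0 : 0 < √α := Real.sqrt_pos.2 hα0
  have hβ0 : 0 ≤ β := by positivity
  set η := -Real.logb 2 π with hηdef
  have hη0 : 0 ≤ η := by
    rw [hηdef, Left.nonneg_neg_iff]; exact Real.logb_nonpos (by norm_num) hπ.le hπ1
  have hQ : ∀ x (y : Fin n → 𝒴), 0 ≤ ∏ i, w x i (y i) := fun x y =>
    Finset.prod_nonneg fun i _ => hw _ _ _
  have hQ1 : ∀ x, ∑ y : Fin n → 𝒴, ∏ i, w x i (y i) = 1 := fun x => by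
    rw [← Fintype.prod_sum]; simp [hw1]
  have hp : ∀ m y, 0 ≤ p m y := fun m y => by
    rw [hpdef]; exact Finset.sum_nonneg fun x _ => mul_nonneg (hr _ _) (hQ _ _)
  have hpm : ∀ m, ∑ y, p m y = ∑ x, r x m := fun m => by
    simp_rw [hpdef]
    rw [Finset.sum_comm]
    simp_rw [← Finset.mul_sum, hQ1, mul_one]
  have hp1 : ∑ m, ∑ y, p m y = 1 := by simp_rw [hpm]; exact hr1
  obtain ⟨Bad, hBadm, hBlo, hBhi⟩ := exists_spectrum_bounds hα0 (by linarith) r hr hr1 w hw hw1 p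
    hpdef hp hp1 p₀ hp₀ hp₀1 hπ hπ1 hpp₀ t ht ht'
  have hpz : ∀ z : 𝓑 × (Fin n → 𝒴), 0 ≤ p z.1 z.2 := fun z => hp _ _
  have hε27 : ε ≤ 1 / 27 := by nlinarith
  have hlogc0 : 0 ≤ Real.logb 2 (Fintype.card 𝒴) :=
    Real.logb_nonneg (by norm_num) (by linarith)
  have hlogc : Real.logb 2 (Fintype.card 𝒴) ≤ Fintype.card 𝒴 := by
    rw [Real.logb_le_iff_le_rpow (by norm_num) (by linarith), Real.rpow_natCast]
    exact_mod_cast Nat.lt_two_pow_self.le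
  have hcardT : Real.logb 2 (Fintype.card (Fin n → 𝒴)) = n * Real.logb 2 (Fintype.card 𝒴) := by
    rw [Fintype.card_fun, Fintype.card_fin, Nat.cast_pow, Real.logb_pow]
  have hdev := abs_sub_entropy_le p hp hp1 Bad (κ := 4 * Fintype.card 𝒴)
    (lo := t - 1 - n * α - η) (hi := t + 1 + β + n * α) (by linarith)
    (by
      rw [hcardT]
      calc (∑ z ∈ Bad, p z.1 z.2) * (n * Real.logb 2 (Fintype.card 𝒴))
          ≤ 7 / 2 * ε * (n * Real.logb 2 (Fintype.card 𝒴)) :=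
            mul_le_mul_of_nonneg_right hBadm (by positivity)
        _ = 7 / 2 * (ε * n) * Real.logb 2 (Fintype.card 𝒴) := by ring
        _ ≤ 7 / 2 * 1 * Real.logb 2 (Fintype.card 𝒴) := by gcongr
        _ ≤ _ := by linarith)
    (by positivity) hBlo hBhi
  refine lt_of_le_of_lt ?_ (show 7 / 2 * ε < 4 * ε by linarith)
  refine le_trans (Finset.sum_le_sum_of_subset_of_nonneg (fun z hz => ?_) fun z _ _ => hpz z) hBadm
  by_contra hzB
  have h1 := hdev z hzB
  have h2 := (Finset.mem_filter.1 hz).2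
  have hsα : n * α ≤ n * √α * 1 := by
    rw [mul_one]
    refine mul_le_mul_of_nonneg_left ?_ hn0.le
    exact Real.le_sqrt_of_sq_le (by nlinarith)
  have h3 : (1 : ℝ) ≤ n * α := by linarith
  have h4 : (n : ℝ) * √α * 1 ≤ n * √α * ℓ := mul_le_mul_of_nonneg_left hℓ (by positivity)
  have e1 : n * ((1 + 16 * Fintype.card 𝒴) * √α * ℓ) =
    n * √α * ℓ + 16 * Fintype.card 𝒴 * (n * √α * ℓ) := by ring
  have e2 : β = n * √α * ℓ + 2 * Fintype.card 𝒴 * (n * √α * 1) := by rw [hβdef]; ring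
  rw [e1] at h2
  have h5 : (Fintype.card 𝒴 : ℝ) * (n * √α * 1) ≤ Fintype.card 𝒴 * (n * √α * ℓ) :=
    mul_le_mul_of_nonneg_left h4 (by linarith)
  have h6 : (Fintype.card 𝒴 : ℝ) * 1 ≤ Fintype.card 𝒴 * (n * √α * ℓ) :=
    mul_le_mul_of_nonneg_left (by linarith) (by linarith)
  have h7 : (2 : ℝ) * (n * √α * ℓ) ≤ Fintype.card 𝒴 * (n * √α * ℓ) :=
    mul_le_mul_of_nonneg_right hc' (by positivity)
  linarith

section Probability

variable (μ : PMF Ω)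

theorem pr_eq_measureReal (E : Set Ω) :
    pr μ E = (@PMF.toMeasure Ω ⊤ μ).real E := by
  let : MeasurableSpace Ω := ⊤
  rw [pr, MeasureTheory.measureReal_def, PMF.toMeasure_apply_eq_toOuterMeasure]

theorem pr_nonneg (E : Set Ω) : 0 ≤ pr μ E := ENNReal.toReal_nonneg

theorem pr_mono {E F : Set Ω} (h : E ⊆ F) : pr μ E ≤ pr μ F := by
  let : MeasurableSpace Ω := ⊤
  rw [pr_eq_measureReal, pr_eq_measureReal]
  exact MeasureTheory.measureReal_mono h

theorem pr_union_le (E F : Set Ω) : pr μ (E ∪ F) ≤ pr μ E + pr μ F := by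
  let : MeasurableSpace Ω := ⊤
  simp_rw [pr_eq_measureReal]
  exact MeasureTheory.measureReal_union_le E F

theorem pr_true : pr μ {_ω | True} = 1 := by
  let : MeasurableSpace Ω := ⊤
  rw [pr_eq_measureReal, Set.ofPred_true]
  exact MeasureTheory.probReal_univ

theorem pr_add_pr_not (P : Ω → Prop) : pr μ {ω | P ω} + pr μ {ω | ¬P ω} = 1 := by
  let : MeasurableSpace Ω := ⊤
  simp_rw [pr_eq_measureReal]
  rw [← MeasureTheory.probReal_univ (μ := (@PMF.toMeasure Ω ⊤ μ))]
  exact MeasureTheory.measureReal_add_measureReal_compl (s := {ω | P ω}) trivial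

theorem pr_eq_sum {β : Type*} [Fintype β] (A : Ω → β) (R : Ω → Prop) :
    pr μ {ω | R ω} = ∑ a, pr μ {ω | A ω = a ∧ R ω} := by
  let : MeasurableSpace Ω := ⊤
  simp_rw [pr_eq_measureReal]
  rw [← MeasureTheory.measureReal_iUnion_fintype]
  · congr 1
    ext ω
    simp
  · intro a b hab
    refine Set.disjoint_left.2 fun ω h1 h2 => hab ?_
    exact h1.1.symm.trans h2.1
  · exact fun _ => trivial

theorem pr_and_eq_sum {β : Type*} [Fintype β] (A : Ω → β) (P : β → Prop) (R : Ω → Prop) :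
    pr μ {ω | P (A ω) ∧ R ω} = ∑ a with P a, pr μ {ω | A ω = a ∧ R ω} := by
  rw [pr_eq_sum μ A, Finset.sum_filter]
  refine Finset.sum_congr rfl fun a _ => ?_
  split_ifs with h
  · congr 1
    ext ω
    simp only [Set.mem_ofPred_eq]
    exact ⟨fun h' => ⟨h'.1, h'.2.2⟩, fun h' => ⟨h'.1, by rw [h'.1]; exact h, h'.2⟩⟩
  · have : {ω | A ω = a ∧ P (A ω) ∧ R ω} = ∅ := by
      ext ω
      simp only [Set.mem_ofPred_eq, Set.mem_empty_iff_false, iff_false]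
      rintro ⟨rfl, h', -⟩
      exact h h'
    rw [this]
    simp [pr]

end Probability

theorem Markov.comp {β γ δ β' δ' : Type*} [Fintype β] [Fintype δ] {μ : PMF Ω} {A : Ω → β}
    {B : Ω → γ} {C : Ω → δ} (h : Markov μ A B C) (φ : β → β') (ψ : δ → δ') :
    Markov μ (fun ω => φ (A ω)) B (fun ω => ψ (C ω)) := by
  intro a b c
  have e1 : pr μ {ω | φ (A ω) = a ∧ B ω = b ∧ ψ (C ω) = c} =
      ∑ a' with φ a' = a, ∑ c' with ψ c' = c, pr μ {ω | A ω = a' ∧ B ω = b ∧ C ω = c'} := by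
    rw [pr_and_eq_sum μ A (fun a' => φ a' = a) fun ω => B ω = b ∧ ψ (C ω) = c]
    refine Finset.sum_congr rfl fun a' _ => ?_
    rw [show {ω | A ω = a' ∧ B ω = b ∧ ψ (C ω) = c} = {ω | ψ (C ω) = c ∧ A ω = a' ∧ B ω = b} by
      ext ω; simp only [Set.mem_ofPred_eq]; tauto]
    rw [pr_and_eq_sum μ C (fun c' => ψ c' = c) fun ω => A ω = a' ∧ B ω = b]
    refine Finset.sum_congr rfl fun c' _ => ?_
    congr 1
    ext ω; simp only [Set.mem_ofPred_eq]; tauto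
  have e2 : pr μ {ω | B ω = b ∧ ψ (C ω) = c} =
      ∑ c' with ψ c' = c, pr μ {ω | B ω = b ∧ C ω = c'} := by
    simp_rw [and_comm (a := B _ = b)]
    exact pr_and_eq_sum μ C (fun c' => ψ c' = c) fun ω => B ω = b
  rw [e1, e2, pr_and_eq_sum μ A (fun a' => φ a' = a) fun ω => B ω = b, Finset.sum_mul_sum,
    Finset.sum_mul]
  refine Finset.sum_congr rfl fun a' _ => ?_
  rw [Finset.sum_mul]
  exact Finset.sum_congr rfl fun c' _ => h a' b c'

theorem pr_and_output_eq_sum {β 𝒳 𝒴 : Type*} [Fintype 𝒳] [Fintype 𝒴] {n : ℕ} {μ : PMF Ω}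
    {A : Ω → β} {X : Ω → Fin n → 𝒳} {Y : Ω → Fin n → 𝒴} {W : Channel 𝒳 𝒴}
    (h : Markov μ A X Y) (hW : IsOutput μ X Y W) (a : β) (y : Fin n → 𝒴) :
    pr μ {ω | A ω = a ∧ Y ω = y} = ∑ x, pr μ {ω | A ω = a ∧ X ω = x} * W.pn n x y := by
  rw [pr_eq_sum μ X]
  refine Finset.sum_congr rfl fun x _ => ?_
  rw [show {ω | X ω = x ∧ A ω = a ∧ Y ω = y} = {ω | A ω = a ∧ X ω = x ∧ Y ω = y} by
    ext ω; simp only [Set.mem_ofPred_eq]; tauto]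
  rcases (pr_nonneg μ {ω | X ω = x}).eq_or_lt with h0 | h0
  · have h1 : pr μ {ω | A ω = a ∧ X ω = x ∧ Y ω = y} = 0 :=
      le_antisymm (h0 ▸ pr_mono μ fun ω hω => hω.2.1) (pr_nonneg _ _)
    have h2 : pr μ {ω | A ω = a ∧ X ω = x} = 0 :=
      le_antisymm (h0 ▸ pr_mono μ fun ω hω => hω.2) (pr_nonneg _ _)
    rw [h1, h2, zero_mul]
  · have h1 := h a x y
    have h2 := hW x y h0
    rw [cpr, div_eq_iff h0.ne'] at h2
    rw [show {ω | X ω = x ∧ Y ω = y} = {ω | Y ω = y} ∩ {ω | X ω = x} by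
      ext ω; simp only [Set.mem_ofPred_eq, Set.mem_inter_iff]; tauto, h2, ← mul_assoc] at h1
    exact mul_right_cancel₀ h0.ne' h1

/-- The least `t` for which the set `{y | q(y) ≥ 2⁻ᵗ ∑ q}` has `Q`-mass at least `ε`,
capped at `N + 1`. -/
def imageIndex {T : Type*} [Fintype T] (N : ℕ) (ε : ℝ) (q Q : T → ℝ) : ℕ :=
  Nat.find (p := fun t => t = N + 1 ∨ ε ≤ ∑ y with ∑ y', q y' ≤ 2 ^ t * q y, Q y)
    ⟨N + 1, Or.inl rfl⟩

section ImageIndex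

variable {T : Type*} [Fintype T] (N : ℕ) (ε : ℝ) (q Q : T → ℝ)

theorem imageIndex_le : imageIndex N ε q Q ≤ N + 1 := Nat.find_min' _ (Or.inl rfl)

theorem le_mass_of_imageIndex_le (h : imageIndex N ε q Q ≤ N) :
    ε ≤ ∑ y with ∑ y', q y' ≤ 2 ^ imageIndex N ε q Q * q y, Q y := by
  have h1 := Nat.find_spec (p := fun t => t = N + 1 ∨
    ε ≤ ∑ y with ∑ y', q y' ≤ 2 ^ t * q y, Q y) ⟨N + 1, Or.inl rfl⟩
  rcases h1 with h1 | h1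
  · exact absurd h1 (by change imageIndex N ε q Q ≠ N + 1; omega)
  · exact h1

theorem mass_lt_of_lt_imageIndex {s : ℕ} (h : s < imageIndex N ε q Q) :
    ∑ y with ∑ y', q y' ≤ 2 ^ s * q y, Q y < ε := by
  have h1 := Nat.find_min (p := fun t => t = N + 1 ∨
    ε ≤ ∑ y with ∑ y', q y' ≤ 2 ^ t * q y, Q y) ⟨N + 1, Or.inl rfl⟩ h
  exact not_le.1 fun h2 => h1 (Or.inr h2)

end ImageIndex

theorem sum_of_light_mass_le {𝒜 𝓑 T : Type*} [Fintype 𝒜] [Fintype 𝓑] [Fintype T]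
    (s : 𝓑 → 𝒜 → ℝ) (hs : ∀ m x, 0 ≤ s m x) (Q : 𝒜 → T → ℝ) (hQ : ∀ x y, 0 ≤ Q x y)
    (p₀ : 𝓑 → T → ℝ) (hp₀ : ∀ m y, p₀ m y = ∑ x, s m x * Q x y) (hp₀1 : ∑ m, ∑ y, p₀ m y = 1)
    {K : ℝ} (hK : 0 < K) (O : 𝓑 → 𝒜 → Prop)
    (hO : ∀ m x, O m x → 1 / 2 ≤ ∑ y with ¬∑ y', p₀ m y' ≤ K * p₀ m y, Q x y) :
    ∑ z : 𝓑 × 𝒜 with O z.1 z.2, s z.1 z.2 ≤ 2 * (Fintype.card T / K) := by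
  have hp₀' : ∀ m y, 0 ≤ p₀ m y := fun m y => by
    rw [hp₀]; exact Finset.sum_nonneg fun x _ => mul_nonneg (hs _ _) (hQ _ _)
  calc ∑ z : 𝓑 × 𝒜 with O z.1 z.2, s z.1 z.2
      ≤ ∑ m, ∑ x, 2 * (s m x * ∑ y with ¬∑ y', p₀ m y' ≤ K * p₀ m y, Q x y) := by
        rw [Finset.sum_filter, Fintype.sum_prod_type]
        refine Finset.sum_le_sum fun m _ => Finset.sum_le_sum fun x _ => ?_
        dsimp only
        split_ifs with h
        · have := mul_le_mul_of_nonneg_left (hO m x h) (hs m x)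
          linarith
        · exact mul_nonneg two_pos.le
            (mul_nonneg (hs _ _) (Finset.sum_nonneg fun y _ => hQ _ _))
    _ = 2 * ∑ m, ∑ y with ¬∑ y', p₀ m y' ≤ K * p₀ m y, p₀ m y := by
        rw [Finset.mul_sum]
        refine Finset.sum_congr rfl fun m _ => ?_
        rw [← Finset.mul_sum]
        congr 1
        simp_rw [Finset.mul_sum]
        rw [Finset.sum_comm]
        exact Finset.sum_congr rfl fun y _ => (hp₀ m y).symm
    _ ≤ 2 * ∑ m, ∑ _y : T, (∑ y', p₀ m y') / K := by
        refine mul_le_mul_of_nonneg_left (Finset.sum_le_sum fun m _ => ?_) two_pos.le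
        have h0 : 0 ≤ (∑ y', p₀ m y') / K :=
          div_nonneg (Finset.sum_nonneg fun y _ => hp₀' m y) hK.le
        rw [Finset.sum_filter]
        refine Finset.sum_le_sum fun y _ => ?_
        split_ifs with h
        · exact h0
        · rw [le_div_iff₀ hK, mul_comm]
          exact (not_le.1 h).le
    _ = _ := by
        simp only [Finset.sum_const, Finset.card_univ, nsmul_eq_mul]
        rw [← Finset.mul_sum, ← Finset.sum_div, hp₀1]
        ring

theorem two_mul_card_pow_div_le {c n N : ℕ} (hc : 2 ≤ c) (hn : 27 ≤ n)
    (hN : (n : ℝ) ^ 2 * Real.logb 2 c ≤ N) :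
    2 * ((c : ℝ) ^ n / 2 ^ N) ≤ 2 ^ (-((n : ℝ) / 2) * Real.logb 2 ((n : ℝ) / 8)) := by
  have hn' : (27 : ℝ) ≤ n := by exact_mod_cast hn
  have hc' : (2 : ℝ) ≤ c := by exact_mod_cast hc
  have hlc : 1 ≤ Real.logb 2 c := by
    rw [Real.le_logb_iff_rpow_le (by norm_num) (by linarith), Real.rpow_one]; exact hc'
  have hcn : (c : ℝ) ^ n = 2 ^ (n * Real.logb 2 c) := by
    rw [mul_comm, Real.rpow_mul two_pos.le, Real.rpow_logb two_pos (by norm_num) (by linarith),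
      Real.rpow_natCast]
  have hln : Real.logb 2 (n / 8) ≤ n := by
    rw [Real.logb_le_iff_le_rpow (by norm_num) (by linarith), Real.rpow_natCast]
    have : (n : ℝ) ≤ 2 ^ n := by exact_mod_cast Nat.lt_two_pow_self.le
    linarith
  have e : 2 * ((c : ℝ) ^ n / 2 ^ N) = 2 ^ (1 + (n * Real.logb 2 c - N)) := by
    rw [Real.rpow_add two_pos, Real.rpow_sub two_pos, hcn, Real.rpow_one, Real.rpow_natCast]
  rw [e]
  refine Real.rpow_le_rpow_of_exponent_le (by norm_num) ?_
  have h1 : (n : ℝ) / 2 * Real.logb 2 (n / 8) ≤ n / 2 * n :=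
    mul_le_mul_of_nonneg_left hln (by linarith)
  have h2 : ((n : ℝ) ^ 2 - n) * 1 ≤ (n ^ 2 - n) * Real.logb 2 c :=
    mul_le_mul_of_nonneg_left hlc (by nlinarith)
  nlinarith

theorem pr_imageIndex_overflow_le {𝓑 𝒳 𝒴 : Type*} [Fintype 𝓑] [Fintype 𝒳] [Fintype 𝒴] {n N : ℕ}
    {μ : PMF Ω} {M : Ω → 𝓑} {X : Ω → Fin n → 𝒳} {Y : Ω → Fin n → 𝒴} {W : Channel 𝒳 𝒴}
    (h : Markov μ M X Y) (hW : IsOutput μ X Y W) {ε : ℝ} (hε : ε ≤ 1 / 2) :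
    pr μ {ω | imageIndex N ε (fun y => pr μ {ω' | M ω' = M ω ∧ Y ω' = y}) (W.pn n (X ω)) = N + 1} ≤
      2 * ((Fintype.card 𝒴 : ℝ) ^ n / 2 ^ N) := by
  have hQ : ∀ x y, 0 ≤ W.pn n x y := fun x y => Finset.prod_nonneg fun i _ => W.nonneg _ _
  have hQ1 : ∀ x, ∑ y, W.pn n x y = 1 := fun x => by
    simp_rw [Channel.pn]; rw [← Fintype.prod_sum]; simp [W.sum_one]
  have h1 := sum_of_light_mass_le (fun m x => pr μ {ω | M ω = m ∧ X ω = x})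
    (fun m x => pr_nonneg _ _) (fun x y => W.pn n x y) hQ
    (fun m y => pr μ {ω | M ω = m ∧ Y ω = y}) (pr_and_output_eq_sum h hW) ?_
    (K := 2 ^ N) (by positivity)
    (fun m x => imageIndex N ε (fun y => pr μ {ω' | M ω' = m ∧ Y ω' = y}) (W.pn n x) = N + 1)
    fun m x hmx => ?_
  · rw [Fintype.card_fun, Fintype.card_fin, Nat.cast_pow] at h1
    refine le_trans (le_of_eq ?_) h1
    have h2 := pr_and_eq_sum μ (fun ω => (M ω, X ω)) (fun z => imageIndex N ε
      (fun y => pr μ {ω' | M ω' = z.1 ∧ Y ω' = y}) (W.pn n z.2) = N + 1) fun _ => True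
    simp only [and_true] at h2
    rw [h2]
    refine Finset.sum_congr rfl fun z _ => ?_
    simp only [Prod.ext_iff]
  · have h2 := pr_eq_sum μ (fun ω => (Y ω, M ω)) fun _ => True
    rw [pr_true, Fintype.sum_prod_type_right] at h2
    rw [h2]
    refine Finset.sum_congr rfl fun m _ => Finset.sum_congr rfl fun y _ => ?_
    congr 1
    ext ω
    simp [and_comm]
  · have h2 := mass_lt_of_lt_imageIndex N ε (fun y => pr μ {ω' | M ω' = m ∧ Y ω' = y})
      (W.pn n x) (s := N) (by omega)
    have h3 := Finset.sum_filter_add_sum_filter_not Finset.univ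
      (fun y => ∑ y', pr μ {ω' | M ω' = m ∧ Y ω' = y'} ≤ 2 ^ N * pr μ {ω' | M ω' = m ∧ Y ω' = y})
      (W.pn n x)
    rw [hQ1] at h3
    linarith

/-- Concentration of `h(Y|M,U)` given `U = u` when the image size index of `(X, M)` is constant on
`U = u`. -/
theorem cpr_deviation_lt {𝓑 𝒰 𝒳 𝒴 : Type*} [Fintype 𝓑] [Fintype 𝒰] [Fintype 𝒳] [Fintype 𝒴]
    (hc : 2 ≤ Fintype.card 𝒴) {n N t : ℕ} (hn : 27 ≤ n) {α : ℝ}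
    (hα : Real.logb 2 n / n < α) (hα1 : α < 1 / (8 * Real.log 2))
    {μ : PMF Ω} {M : Ω → 𝓑} {X : Ω → Fin n → 𝒳} {Y : Ω → Fin n → 𝒴} {U : Ω → 𝒰}
    {W : Channel 𝒳 𝒴} (h : Markov μ (fun ω => (U ω, M ω)) X Y) (hW : IsOutput μ X Y W)
    {u : 𝒰} (htN : t ≤ N)
    (ht : ∀ x m, 0 < pr μ {ω | (U ω, M ω) = (u, m) ∧ X ω = x} →
      imageIndex N ((2 : ℝ) ^ (-(n : ℝ) * α)) (fun y => pr μ {ω | M ω = m ∧ Y ω = y})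
        (W.pn n x) = t) :
    cpr μ {ω | |(- Real.logb 2 (cpr μ {ω' | Y ω' = Y ω}
        ({ω' | M ω' = M ω} ∩ {ω' | U ω' = U ω}))) - HcEvt μ Y M {ω' | U ω' = u}| >
          n * ((1 + 16 * Fintype.card 𝒴) * √α * (-Real.logb 2 α)) + 3 * hs μ U u}
      {ω | U ω = u} < 4 * 2 ^ (-(n : ℝ) * α) := by
  rcases (pr_nonneg μ {ω | U ω = u}).eq_or_lt with h0 | hπ
  · rw [cpr, ← h0, div_zero]; positivity
  set π := pr μ {ω | U ω = u} with hπdef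
  have hπ1 : π ≤ 1 := by
    rw [← pr_true μ]; exact pr_mono μ fun _ _ => trivial
  have hr1 : ∑ m, ∑ x, pr μ {ω | (U ω, M ω) = (u, m) ∧ X ω = x} = π := by
    have h2 := pr_eq_sum μ (fun ω => (X ω, M ω)) fun ω => U ω = u
    rw [← hπdef, Fintype.sum_prod_type_right] at h2
    rw [h2]
    refine Finset.sum_congr rfl fun m _ => Finset.sum_congr rfl fun y _ => ?_
    congr 1
    ext ω
    simp only [Prod.ext_iff, Set.mem_ofPred_eq]; tauto
  have hp₀1 : ∑ m, ∑ y, pr μ {ω | M ω = m ∧ Y ω = y} = 1 := by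
    have h2 := pr_eq_sum μ (fun ω => (Y ω, M ω)) fun _ => True
    rw [pr_true, Fintype.sum_prod_type_right] at h2
    rw [h2]
    refine Finset.sum_congr rfl fun m _ => Finset.sum_congr rfl fun y _ => ?_
    congr 1
    ext ω
    simp [and_comm]
  set p : 𝓑 → (Fin n → 𝒴) → ℝ := fun m y => pr μ {ω | (U ω, M ω) = (u, m) ∧ Y ω = y} / π with hp
  have key := mixture_concentration hc hn hα hα1
    (fun x m => pr μ {ω | (U ω, M ω) = (u, m) ∧ X ω = x} / π)
    (fun x m => div_nonneg (pr_nonneg _ _) hπ.le)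
    (by simp_rw [← Finset.sum_div]; rw [hr1, div_self hπ.ne'])
    (fun x i y => W.w (x i) y) (fun x i y => W.nonneg _ _) (fun x i => W.sum_one _) p
    (fun m y => by
      rw [hp]
      dsimp only
      rw [pr_and_output_eq_sum h hW, Finset.sum_div]
      refine Finset.sum_congr rfl fun x _ => ?_
      rw [Channel.pn]; ring)
    (fun m y => pr μ {ω | M ω = m ∧ Y ω = y}) (fun m y => pr_nonneg _ _) hp₀1 hπ hπ1
    (fun m y => by
      rw [hp]
      dsimp only
      rw [mul_div_cancel₀ _ hπ.ne']
      refine pr_mono μ fun ω hω => ⟨(Prod.ext_iff.1 hω.1).2, hω.2⟩) t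
    (fun x m hx => by
      have h1 := ht x m ((div_pos_iff_of_pos_right hπ).1 hx)
      have h2 := le_mass_of_imageIndex_le N _ _ _ (h1.trans_le htN)
      rw [h1] at h2
      exact h2)
    (fun s hs x m hx => by
      have h1 := ht x m ((div_pos_iff_of_pos_right hπ).1 hx)
      exact (mass_lt_of_lt_imageIndex N _ (fun y => pr μ {ω | M ω = m ∧ Y ω = y}) (W.pn n x)
        (by rw [h1, hs]; exact Nat.lt_succ_self s)).le)
  have hcond : ∀ m y, cpr μ {ω' | Y ω' = y} ({ω' | M ω' = m} ∩ {ω' | U ω' = u}) =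
      p m y / ∑ y, p m y := by
    intro m y
    have e1 : pr μ ({ω' | M ω' = m} ∩ {ω' | U ω' = u}) =
        ∑ y, pr μ {ω | (U ω, M ω) = (u, m) ∧ Y ω = y} := by
      have := pr_eq_sum μ Y fun ω => (U ω, M ω) = (u, m)
      simp_rw [and_comm (a := Y _ = _)] at this
      rw [← this]
      congr 1
      ext ω
      simp [and_comm]
    rw [hp, cpr, e1]
    dsimp only
    rw [← Finset.sum_div, div_div_div_cancel_right₀ hπ.ne']
    congr 2
    ext ω
    simp only [Prod.ext_iff, Set.mem_ofPred_eq, Set.mem_inter_iff]; tauto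
  have hH : HcEvt μ Y M {ω' | U ω' = u} =
      ∑ z : 𝓑 × (Fin n → 𝒴), p z.1 z.2 * -Real.logb 2 (p z.1 z.2 / ∑ y, p z.1 y) := by
    rw [HcEvt, Fintype.sum_prod_type_right, ← Finset.sum_neg_distrib]
    refine Finset.sum_congr rfl fun y _ => ?_
    rw [← Finset.sum_neg_distrib]
    refine Finset.sum_congr rfl fun m _ => ?_
    rw [hcond, ← mul_neg]
    congr 1
    rw [hp, cpr]
    dsimp only
    congr 2
    ext ω
    simp only [Prod.ext_iff, Set.mem_ofPred_eq, Set.mem_inter_iff]; tauto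
  refine lt_of_eq_of_lt ?_ key
  rw [hH, cpr, ← hπdef]
  generalize (∑ z : 𝓑 × (Fin n → 𝒴), p z.1 z.2 * -Real.logb 2 (p z.1 z.2 / ∑ y, p z.1 y)) = H
  rw [div_eq_iff hπ.ne', Finset.sum_mul]
  have h2 := pr_and_eq_sum μ (fun ω => (M ω, Y ω)) (fun z =>
    n * ((1 + 16 * Fintype.card 𝒴) * √α * (-Real.logb 2 α)) + 3 * (-Real.logb 2 π) <
      |-Real.logb 2 (p z.1 z.2 / ∑ y, p z.1 y) - H|) fun ω => U ω = u
  convert h2 using 2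
  · ext ω
    simp only [Set.mem_ofPred_eq, Set.mem_inter_iff, gt_iff_lt]
    refine and_congr_left fun hω => ?_
    rw [hω, hcond, hs]
  · rw [hp]
    dsimp only
    rw [div_mul_cancel₀ _ hπ.ne']
    congr 1
    ext ω
    simp only [Prod.ext_iff, Set.mem_ofPred_eq]; tauto

/-- Theorem `thm:mt`, information stabilizing partitions. -/
theorem information_stabilizing_partitions (c𝒴 : ℕ) :
    ∃ C : ℝ, 0 < C ∧
      ∀ (𝒳 𝒴 : Type) [Fintype 𝒳] [Fintype 𝒴], Fintype.card 𝒴 = c𝒴 →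
      2 ≤ Fintype.card 𝒳 → 2 ≤ Fintype.card 𝒴 →
      ∀ (n : ℕ), 27 ≤ n → ∀ l k : ℕ, 0 < l → 0 < k →
      ∀ (Ω : Type) (μ : PMF Ω) (𝓜 : Fin l → Type) [∀ j, Fintype (𝓜 j)]
        (M : ∀ j, Ω → 𝓜 j) (X : Ω → Fin n → 𝒳)
        (W : Fin k → Channel 𝒳 𝒴) (Y : Fin k → Ω → Fin n → 𝒴),
        Markov μ (fun ω => fun j => M j ω) X (fun ω => fun i => Y i ω) →
        (∀ i, IsOutput μ X (Y i) (W i)) →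
      ∀ α : ℝ, Real.logb 2 n / n < α → α < 1 / (8 * Real.log 2) →
      ∃ (𝒱 : Type) (_ : Fintype 𝒱) (f : ((Fin n → 𝒳) × (∀ j, 𝓜 j)) → 𝒱) (δ : ℝ),
        ((Fintype.card 𝒱 : ℝ) ≤
          (2 * (n : ℝ) ^ 3 * Real.logb 2 (Fintype.card 𝒴)) ^ (l * k)) ∧
        0 < δ ∧ δ ≤ C * Real.sqrt α * (- Real.logb 2 α) ∧
        ∀ (𝒰 : Type) [Fintype 𝒰], ∀ (U : Ω → 𝒰),
          (∃ g : 𝒰 → 𝒱, pr μ {ω | f (X ω, fun j => M j ω) = g (U ω)} = 1) →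
          Markov μ (fun ω => (U ω, fun j => M j ω)) X (fun ω => fun i => Y i ω) →
          ∀ i : Fin k, ∀ j : Fin l,
            ∃ 𝒰s : Set 𝒰,
              1 - 2 ^ (-((n : ℝ) / 2) * Real.logb 2 ((n : ℝ) / 8)) ≤
                pr μ {ω | U ω ∈ 𝒰s} ∧
              ∀ u ∈ 𝒰s,
                cpr μ
                  {ω | |(- Real.logb 2 (cpr μ {ω' | Y i ω' = Y i ω}
                          ({ω' | M j ω' = M j ω} ∩ {ω' | U ω' = U ω}))) -
                      HcEvt μ (Y i) (M j) {ω' | U ω' = u}| >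
                    n * δ + 3 * hs μ U u}
                  {ω | U ω = u} < 4 * 2 ^ (-(n : ℝ) * α) := by
  refine ⟨1 + 16 * c𝒴, by positivity, ?_⟩
  intro 𝒳 𝒴 _ _ hcard h𝒳 h𝒴 n hn l k hl hk Ω μ 𝓜 _ M X W Y hMarkov hOut α hα hα1
  subst hcard
  have hn' : (27 : ℝ) ≤ n := by exact_mod_cast hn
  have hn0 : (0 : ℝ) < n := by linarith
  have hc' : (2 : ℝ) ≤ Fintype.card 𝒴 := by exact_mod_cast h𝒴
  have hlc : 1 ≤ Real.logb 2 (Fintype.card 𝒴) := by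
    rw [Real.le_logb_iff_rpow_le (by norm_num) (by linarith), Real.rpow_one]; exact hc'
  have hα0 : 0 < α := by
    refine lt_of_le_of_lt (div_nonneg (Real.logb_nonneg (by norm_num) (by linarith)) hn0.le) hα
  have hα2 : α < 1 := by
    refine hα1.trans ?_
    rw [div_lt_one (mul_pos (by norm_num) (Real.log_pos (by norm_num)))]
    linarith [Real.log_two_gt_d9]
  have hε : (2 : ℝ) ^ (-(n : ℝ) * α) ≤ 1 / 2 := by
    rw [div_lt_iff₀ hn0] at hα
    have h1 : 1 ≤ Real.logb 2 n := by
      rw [Real.le_logb_iff_rpow_le (by norm_num) hn0, Real.rpow_one]; linarith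
    calc (2 : ℝ) ^ (-(n : ℝ) * α) ≤ 2 ^ (-1 : ℝ) :=
          Real.rpow_le_rpow_of_exponent_le (by norm_num) (by linarith)
      _ = 1 / 2 := by rw [Real.rpow_neg_one]; norm_num
  set N := ⌈(n : ℝ) ^ 2 * Real.logb 2 (Fintype.card 𝒴)⌉₊ with hN
  let q : ∀ (i : Fin k) (j : Fin l), 𝓜 j → (Fin n → 𝒴) → ℝ :=
    fun i j m y => pr μ {ω | M j ω = m ∧ Y i ω = y}
  let f : ((Fin n → 𝒳) × (∀ j, 𝓜 j)) → (Fin l × Fin k → Fin (N + 2)) := fun z v =>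
    ⟨imageIndex N ((2 : ℝ) ^ (-(n : ℝ) * α)) (q v.2 v.1 (z.2 v.1)) ((W v.2).pn n z.1),
      Nat.lt_succ_of_le (imageIndex_le _ _ _ _)⟩
  refine ⟨Fin l × Fin k → Fin (N + 2), inferInstance, f,
    (1 + 16 * Fintype.card 𝒴) * √α * (-Real.logb 2 α), ?_, ?_, le_rfl, ?_⟩
  · rw [Fintype.card_fun, Fintype.card_fin, Fintype.card_prod, Fintype.card_fin, Fintype.card_fin,
      Nat.cast_pow]
    refine pow_le_pow_left₀ (Nat.cast_nonneg _) ?_ _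
    have h1 : (N : ℝ) < n ^ 2 * Real.logb 2 (Fintype.card 𝒴) + 1 :=
      Nat.ceil_lt_add_one (by positivity)
    have h2 : (3 : ℝ) * 1 ≤ n ^ 2 * Real.logb 2 (Fintype.card 𝒴) :=
      mul_le_mul (by nlinarith) hlc (by norm_num) (by positivity)
    have h3 : (2 : ℝ) * (n ^ 2 * Real.logb 2 (Fintype.card 𝒴)) ≤
        2 * n * (n ^ 2 * Real.logb 2 (Fintype.card 𝒴)) :=
      mul_le_mul_of_nonneg_right (by linarith) (by positivity)
    push_cast
    nlinarith
  · have : Real.logb 2 α < 0 := Real.logb_neg (by norm_num) hα0 hα2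
    have h2 : 0 < √α := Real.sqrt_pos.2 hα0
    have h3 : 0 < -Real.logb 2 α := by linarith
    positivity
  intro 𝒰 _ U ⟨g, hg⟩ hU i j
  have hne : pr μ {ω | ¬f (X ω, fun j => M j ω) = g (U ω)} = 0 := by
    linarith [pr_add_pr_not μ fun ω => f (X ω, fun j => M j ω) = g (U ω)]
  refine ⟨{u | (g u (j, i) : ℕ) ≤ N}, ?_, fun u hu => ?_⟩
  · have h1 : pr μ {ω | imageIndex N ((2 : ℝ) ^ (-(n : ℝ) * α)) (q i j (M j ω))
        ((W i).pn n (X ω)) = N + 1} ≤ 2 * ((Fintype.card 𝒴 : ℝ) ^ n / 2 ^ N) :=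
      pr_imageIndex_overflow_le (hMarkov.comp (fun m => m j) fun y => y i) (hOut i) hε
    have h2 := two_mul_card_pow_div_le h𝒴 hn (Nat.le_ceil _ : _ ≤ (N : ℝ))
    have h3 := pr_add_pr_not μ fun ω => imageIndex N ((2 : ℝ) ^ (-(n : ℝ) * α)) (q i j (M j ω))
        ((W i).pn n (X ω)) = N + 1
    have h4 : pr μ {ω | ¬imageIndex N ((2 : ℝ) ^ (-(n : ℝ) * α)) (q i j (M j ω))
        ((W i).pn n (X ω)) = N + 1} ≤ pr μ ({ω | U ω ∈ {u | (g u (j, i) : ℕ) ≤ N}} ∪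
          {ω | ¬f (X ω, fun j => M j ω) = g (U ω)}) := by
      refine pr_mono μ fun ω hω => ?_
      by_cases hω' : f (X ω, fun j => M j ω) = g (U ω)
      · left
        change ((g (U ω) (j, i) : Fin (N + 2)) : ℕ) ≤ N
        rw [← hω']
        have h5 := imageIndex_le N ((2 : ℝ) ^ (-(n : ℝ) * α)) (q i j (M j ω)) ((W i).pn n (X ω))
        have h6 : imageIndex N ((2 : ℝ) ^ (-(n : ℝ) * α)) (q i j (M j ω)) ((W i).pn n (X ω)) ≠
          N + 1 := hω
        change imageIndex N ((2 : ℝ) ^ (-(n : ℝ) * α)) (q i j (M j ω)) ((W i).pn n (X ω)) ≤ N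
        omega
      · right
        exact hω'
    have h5 := pr_union_le μ {ω | U ω ∈ {u | (g u (j, i) : ℕ) ≤ N}}
      {ω | ¬f (X ω, fun j => M j ω) = g (U ω)}
    linarith
  · refine cpr_deviation_lt h𝒴 hn hα hα1
      (hU.comp (fun z => (z.1, z.2 j)) fun y => y i) (hOut i) hu fun x m hxm => ?_
    by_contra hcon
    refine hxm.ne' (le_antisymm (hne ▸ pr_mono μ fun ω hω hω' => hcon ?_) (pr_nonneg _ _))
    obtain ⟨h1, h2⟩ := hω
    obtain ⟨h3, h4⟩ := Prod.ext_iff.1 h1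
    have h5 := congrArg (fun v => ((v (j, i) : Fin (N + 2)) : ℕ)) hω'
    dsimp only at h3 h4 h5
    rw [h3] at h5
    rw [← h5, ← h2, ← h4]

end Paper
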